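/- arXiv:1408.0159 — 4 statements merged into one kernel-verified Lean document; each statement's English description precedes it below -/
import Mathlib

section
/- Let φ : ℝⁿ × (0,∞) → (0,∞) satisfy the doubling condition (D), the nearness condition (N) and the almost-increasing condition (I). Then for every 1 ≤ p < ∞ the Campanato spaces for exponents p and 1 coincide with equivalent (semi)norms: there is a constant C > 0 such that for every f ∈ L^p_loc(ℝⁿ), C⁻¹‖f‖_{𝓛_{1,φ}} ≤ ‖f‖_{𝓛_{p,φ}} ≤ C‖f‖_{𝓛_{1,φ}}, and consequently C⁻¹‖f‖_{𝓛𝓝_{1,φ}} ≤ ‖f‖_{𝓛𝓝_{p,φ}} ≤ C‖f‖_{𝓛𝓝_{1,φ}}. -/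
open MeasureTheory Metric Filter
open scoped ENNReal NNReal

noncomputable section

/-- Average of `f` over the ball `B(x,r)`. -/
def ballAvg {n : ℕ} (f : EuclideanSpace ℝ (Fin n) → ℝ) (x : EuclideanSpace ℝ (Fin n))
    (r : ℝ) : ℝ :=
  (volume (ball x r)).toReal⁻¹ * ∫ y in ball x r, f y

/-- Campanato seminorm with variable growth function `φ`. -/
def campSemi {n : ℕ} (p : ℝ) (φ : EuclideanSpace ℝ (Fin n) → ℝ → ℝ)
    (f : EuclideanSpace ℝ (Fin n) → ℝ) : ℝ≥0∞ :=
  ⨆ (x : EuclideanSpace ℝ (Fin n)) (r : ℝ) (_ : 0 < r),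
    ENNReal.ofReal ((φ x r)⁻¹ *
      ((volume (ball x r)).toReal⁻¹ * ∫ y in ball x r, |f y - ballAvg f x r| ^ p) ^ (1 / p))

/-- Campanato norm: seminorm plus `|f_{B(0,1)}|`. -/
def campNorm {n : ℕ} (p : ℝ) (φ : EuclideanSpace ℝ (Fin n) → ℝ → ℝ)
    (f : EuclideanSpace ℝ (Fin n) → ℝ) : ℝ≥0∞ :=
  campSemi p φ f + ENNReal.ofReal |ballAvg f 0 1|

/-- Morrey norm with variable growth function `φ`. -/
def morreyNorm {n : ℕ} (p : ℝ) (φ : EuclideanSpace ℝ (Fin n) → ℝ → ℝ)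
    (f : EuclideanSpace ℝ (Fin n) → ℝ) : ℝ≥0∞ :=
  ⨆ (x : EuclideanSpace ℝ (Fin n)) (r : ℝ) (_ : 0 < r),
    ENNReal.ofReal ((φ x r)⁻¹ *
      ((volume (ball x r)).toReal⁻¹ * ∫ y in ball x r, |f y| ^ p) ^ (1 / p))

/-- Hölder seminorm with variable growth function `φ`. -/
def holderSemi {n : ℕ} (φ : EuclideanSpace ℝ (Fin n) → ℝ → ℝ)
    (f : EuclideanSpace ℝ (Fin n) → ℝ) : ℝ≥0∞ :=
  ⨆ (x : EuclideanSpace ℝ (Fin n)) (y : EuclideanSpace ℝ (Fin n)) (_ : x ≠ y),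
    ENNReal.ofReal (2 * |f x - f y| / (φ x (dist x y) + φ y (dist x y)))

/-- The doubling condition (D) with constant `A`. -/
def DoublingWith {n : ℕ} (A : ℝ) (φ : EuclideanSpace ℝ (Fin n) → ℝ → ℝ) : Prop :=
  ∀ (x : EuclideanSpace ℝ (Fin n)) (r s : ℝ), 0 < r → 0 < s →
    1 / 2 ≤ s / r → s / r ≤ 2 → A⁻¹ ≤ φ x s / φ x r ∧ φ x s / φ x r ≤ A

/-- The doubling condition (D). -/
def Doubling {n : ℕ} (φ : EuclideanSpace ℝ (Fin n) → ℝ → ℝ) : Prop :=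
  ∃ A > 0, DoublingWith A φ

/-- The nearness condition (N). -/
def Nearness {n : ℕ} (φ : EuclideanSpace ℝ (Fin n) → ℝ → ℝ) : Prop :=
  ∃ A > 0, ∀ (x y : EuclideanSpace ℝ (Fin n)) (r : ℝ), 0 < r → dist x y ≤ r →
    A⁻¹ ≤ φ x r / φ y r ∧ φ x r / φ y r ≤ A

/-- The almost increasing condition (I). -/
def AlmostIncreasing {n : ℕ} (φ : EuclideanSpace ℝ (Fin n) → ℝ → ℝ) : Prop :=
  ∃ A > 0, ∀ (x : EuclideanSpace ℝ (Fin n)) (r s : ℝ), 0 < r → r < s → φ x r ≤ A * φ x s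

/-- Positivity of the variable growth function. -/
def GrowthPos {n : ℕ} (φ : EuclideanSpace ℝ (Fin n) → ℝ → ℝ) : Prop :=
  ∀ (x : EuclideanSpace ℝ (Fin n)) (r : ℝ), 0 < r → 0 < φ x r

/-- `f ∈ L^p_loc(ℝⁿ)` (in particular `f ∈ L¹_loc`). -/
def MemLpLoc {n : ℕ} (p : ℝ) (f : EuclideanSpace ℝ (Fin n) → ℝ) : Prop :=
  LocallyIntegrable f volume ∧
    ∀ (x : EuclideanSpace ℝ (Fin n)) (r : ℝ), 0 < r →
      IntegrableOn (fun y => |f y| ^ p) (ball x r) volume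


lemma vol_scale {n : ℕ} (x y : EuclideanSpace ℝ (Fin n)) {c : ℝ} (hc : 0 < c) (s : ℝ) :
    volume (ball y (c * s)) = ENNReal.ofReal (c ^ n) * volume (ball x s) := by
  rw [Measure.addHaar_ball_mul_of_pos _ _ hc, Measure.addHaar_ball_center volume x s]
  simp

lemma vol_pos {n : ℕ} (x : EuclideanSpace ℝ (Fin n)) {r : ℝ} (hr : 0 < r) :
    volume (ball x r) ≠ 0 := (measure_ball_pos _ _ hr).ne'

lemma vol_fin {n : ℕ} (x : EuclideanSpace ℝ (Fin n)) (r : ℝ) :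
    volume (ball x r) ≠ ⊤ := measure_ball_lt_top.ne

lemma intOn_ball {n : ℕ} {g : EuclideanSpace ℝ (Fin n) → ℝ} (hg : LocallyIntegrable g volume)
    (x : EuclideanSpace ℝ (Fin n)) (r : ℝ) : IntegrableOn g (ball x r) volume :=
  (hg.integrableOn_isCompact (isCompact_closedBall x r)).mono_set ball_subset_closedBall

lemma mean_diff {n : ℕ} {g : EuclideanSpace ℝ (Fin n) → ℝ} (hg : LocallyIntegrable g volume)
    (x : EuclideanSpace ℝ (Fin n)) {r : ℝ} (hr : 0 < r) (c : ℝ) :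
    ‖ballAvg g x r - c‖ₑ * volume (ball x r) ≤ ∫⁻ y in ball x r, ‖g y - c‖ₑ := by
  have hv := vol_pos x hr
  have hf := vol_fin x r
  have hV : 0 < (volume (ball x r)).toReal := ENNReal.toReal_pos hv hf
  refine le_trans (le_of_eq ?_) (enorm_integral_le_lintegral_enorm _)
  have : ∫ y in ball x r, (g y - c) = (ballAvg g x r - c) * (volume (ball x r)).toReal := by
    rw [integral_sub (intOn_ball hg x r) (integrableOn_const hf)]
    simp only [ballAvg, integral_const, smul_eq_mul, Measure.real, Measure.restrict_apply_univ]
    field_simp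
  rw [this, enorm_mul]
  congr 1
  rw [Real.enorm_of_nonneg hV.le, ENNReal.ofReal_toReal hf]

lemma osc_le {n : ℕ} {g : EuclideanSpace ℝ (Fin n) → ℝ} (hg : LocallyIntegrable g volume)
    (x : EuclideanSpace ℝ (Fin n)) {r : ℝ} (hr : 0 < r) (c : ℝ) :
    ∫⁻ y in ball x r, ‖g y - ballAvg g x r‖ₑ ≤ 2 * ∫⁻ y in ball x r, ‖g y - c‖ₑ := by
  calc ∫⁻ y in ball x r, ‖g y - ballAvg g x r‖ₑ 
      ≤ ∫⁻ y in ball x r, (‖g y - c‖ₑ + ‖ballAvg g x r - c‖ₑ) := by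
        refine lintegral_mono fun y => ?_
        have : g y - ballAvg g x r = (g y - c) - (ballAvg g x r - c) := by ring
        rw [this]
        exact enorm_sub_le
    _ = (∫⁻ y in ball x r, ‖g y - c‖ₑ) + ‖ballAvg g x r - c‖ₑ * volume (ball x r) := by
        rw [lintegral_add_right _ measurable_const]; simp
    _ ≤ _ := by
        rw [two_mul]; gcongr; exact mean_diff hg x hr c

lemma double_bound {n : ℕ} {g : EuclideanSpace ℝ (Fin n) → ℝ} (hg : LocallyIntegrable g volume)
    (x : EuclideanSpace ℝ (Fin n)) {r : ℝ} (hr : 0 < r) {A : ℝ≥0∞}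
    (hA : ∫⁻ y in ball x (2 * r), ‖g y - ballAvg g x (2 * r)‖ₑ ≤ A * volume (ball x (2 * r))) :
    ∫⁻ y in ball x (2 * r), ‖g y - ballAvg g x r‖ₑ ≤ 2 ^ n * (1 + 2 ^ n) * A * volume (ball x r) := by
  have h2 : volume (ball x (2 * r)) = 2 ^ n * volume (ball x r) := by
    rw [vol_scale x x two_pos r]; simp [ENNReal.ofReal_pow]
  set m := ballAvg g x (2 * r)
  have hmd : ‖ballAvg g x r - m‖ₑ * volume (ball x r) ≤ A * volume (ball x (2 * r)) :=
    (mean_diff hg x hr m).trans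
      ((lintegral_mono_set (ball_subset_ball (by linarith))).trans hA)
  calc ∫⁻ y in ball x (2 * r), ‖g y - ballAvg g x r‖ₑ 
      ≤ ∫⁻ y in ball x (2 * r), (‖g y - m‖ₑ + ‖ballAvg g x r - m‖ₑ) := by
        refine lintegral_mono fun y => ?_
        have : g y - ballAvg g x r = (g y - m) - (ballAvg g x r - m) := by ring
        rw [this]
        exact enorm_sub_le
    _ = (∫⁻ y in ball x (2 * r), ‖g y - m‖ₑ) 
          + ‖ballAvg g x r - m‖ₑ * volume (ball x (2 * r)) := by
        rw [lintegral_add_right _ measurable_const]; simp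
    _ = (∫⁻ y in ball x (2 * r), ‖g y - m‖ₑ) 
          + 2 ^ n * (‖ballAvg g x r - m‖ₑ * volume (ball x r)) := by
        rw [h2]; ring
    _ ≤ A * volume (ball x (2 * r)) + 2 ^ n * (A * volume (ball x (2 * r))) := by gcongr
    _ = _ := by rw [h2]; ring

/-- Lebesgue differentiation along a sequence of balls. -/
lemma ae_le_of_avg {n : ℕ} {g : EuclideanSpace ℝ (Fin n) → ℝ} (hg : LocallyIntegrable g volume)
    (b : ℝ) (s : ℕ → ℝ) (hs : ∀ k, 0 < s k) (hs0 : Tendsto s atTop (nhds 0)) (lam : ℝ≥0∞) :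
    ∀ᵐ y : EuclideanSpace ℝ (Fin n), 
      (∀ k, ∫⁻ z in ball y (s k), ‖g z - b‖ₑ ≤ lam * volume (ball y (s k))) → ‖g y - b‖ₑ ≤ lam := by
  have hh : LocallyIntegrable (fun y => ‖g y - b‖) volume :=
    fun x => by simpa using ((hg.sub (locallyIntegrable_const b)) x).norm
  filter_upwards [IsUnifLocDoublingMeasure.ae_tendsto_average volume hh 1] with y hy hk
  have ht := hy (fun _ : ℕ => y) s (l := atTop)
    (tendsto_nhdsWithin_iff.2 ⟨hs0, Eventually.of_forall hs⟩)
    (Eventually.of_forall fun k => mem_closedBall_self (by simpa using (hs k).le))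
  have ht' := ENNReal.tendsto_ofReal ht
  rw [ofReal_norm] at ht'
  refine le_of_tendsto ht' (Eventually.of_forall fun k => ?_)
  have hE : (closedBall y (s k) : Set _) =ᵐ[volume] ball y (s k) := by
    have h0 := Measure.addHaar_sphere_of_ne_zero (volume : Measure (EuclideanSpace ℝ (Fin n))) y
      (hs k).ne'
    rw [← ball_union_sphere]
    exact union_ae_eq_left_of_ae_eq_empty (ae_eq_empty.2 h0)
  have hi : Integrable (fun z => g z - b) (volume.restrict (ball y (s k))) :=
    (intOn_ball hg y (s k)).sub (integrableOn_const (vol_fin y (s k)))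
  rw [setAverage_congr hE, setAverage_eq, smul_eq_mul, Measure.real,
    ENNReal.ofReal_mul (by positivity), 
    ofReal_integral_norm_eq_lintegral_enorm hi,
    ENNReal.ofReal_inv_of_pos (ENNReal.toReal_pos (vol_pos y (hs k)) (vol_fin y _)),
    ENNReal.ofReal_toReal (vol_fin y _), mul_comm, ← div_eq_mul_inv]
  exact ENNReal.div_le_of_le_mul (hk k)

/-- Selection of stopping balls. -/
lemma stopping {n : ℕ} {g : EuclideanSpace ℝ (Fin n) → ℝ} (hg : LocallyIntegrable g volume)
    (x : EuclideanSpace ℝ (Fin n)) {r : ℝ} (hr : 0 < r) (b : ℝ) {lam I : ℝ≥0∞}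
    (hlam : lam ≠ 0) (hlam' : lam ≠ ⊤) (hI' : I ≠ ⊤)
    (hI : ∫⁻ y in ball x (2 * r), ‖g y - b‖ₑ ≤ I)
    (hIl : 2 ^ n * I ≤ lam * volume (ball x r)) :
    ∃ (u : Set (EuclideanSpace ℝ (Fin n))) (ρ : EuclideanSpace ℝ (Fin n) → ℝ),
      u.Countable ∧ (∀ y ∈ u, y ∈ ball x r ∧ 0 < ρ y ∧ ρ y ≤ r / 2 ∧ 
        ‖ballAvg g y (ρ y) - b‖ₑ ≤ lam) ∧
      (∑' y : u, volume (ball (y : EuclideanSpace ℝ (Fin n)) (ρ y))) ≤ 6 ^ n * (I / lam) ∧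
      ∀ᵐ y, y ∈ ball x r \ (⋃ z ∈ u, ball z (ρ z)) → ‖g y - b‖ₑ ≤ lam := by
  classical
  let s : ℕ → ℝ := fun k => r / 2 * (1 / 6) ^ k
  have hs : ∀ k, 0 < s k := fun k => by positivity
  have hs0 : Tendsto s atTop (nhds 0) := by
    have := (tendsto_pow_atTop_nhds_zero_of_lt_one (r := (1 / 6 : ℝ)) (by norm_num) 
      (by norm_num)).const_mul (r / 2)
    rw [mul_zero] at this
    exact this
  have hsle : ∀ k, s k ≤ r / 2 := fun k => by
    have : ((1 : ℝ) / 6) ^ k ≤ 1 := pow_le_one₀ (by norm_num) (by norm_num)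
    have := mul_le_mul_of_nonneg_left this (by positivity : 0 ≤ r / 2)
    simpa [s] using this
  have hsucc : ∀ k, 6 * s (k + 1) = s k := fun k => by simp only [s, pow_succ]; ring
  let P : EuclideanSpace ℝ (Fin n) → ℕ → Prop := fun y k =>
    lam * volume (ball y (s k)) < ∫⁻ z in ball y (s k), ‖g z - b‖ₑ 
  have hsub : ∀ y ∈ ball x r, ∀ k, ball y (s k) ⊆ ball x (2 * r) := fun y hy k => by
    refine ball_subset_ball' ?_
    have := mem_ball.1 hy
    have := hsle k
    linarith
  have hP0 : ∀ y ∈ ball x r, ¬ P y 0 := fun y hy => by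
    simp only [P, not_lt]
    have e : volume (ball x r) = 2 ^ n * volume (ball y (s 0)) := by
      have := vol_scale y x two_pos (s 0)
      have e2 : 2 * s 0 = r := by simp [s]; ring
      rw [e2] at this
      rw [this]; simp [ENNReal.ofReal_pow]
    have h1 : ∫⁻ z in ball y (s 0), ‖g z - b‖ₑ ≤ I :=
      (lintegral_mono_set (hsub y hy 0)).trans hI
    refine h1.trans ?_
    have h2n : (2 : ℝ≥0∞) ^ n ≠ 0 := by positivity
    have h2n' : (2 : ℝ≥0∞) ^ n ≠ ⊤ := by finiteness
    rw [← ENNReal.mul_le_mul_iff_right h2n h2n']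
    refine hIl.trans (le_of_eq ?_)
    rw [e]; ring
  let S : Set (EuclideanSpace ℝ (Fin n)) := {y | y ∈ ball x r ∧ ∃ k, P y k}
  let κ : EuclideanSpace ℝ (Fin n) → ℕ := fun y => if h : ∃ k, P y k then Nat.find h else 0
  have hκ : ∀ y ∈ S, P y (κ y) := fun y hy => by
    simp only [κ, dif_pos hy.2]; exact Nat.find_spec hy.2
  have hκ1 : ∀ y ∈ S, ∃ j, κ y = j + 1 ∧ ¬ P y j := fun y hy => by
    have h0 : κ y ≠ 0 := fun h0 => hP0 y hy.1 (h0 ▸ hκ y hy)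
    obtain ⟨j, hj⟩ := Nat.exists_eq_succ_of_ne_zero h0
    refine ⟨j, hj, ?_⟩
    refine Nat.find_min hy.2 ?_
    simp only [κ, dif_pos hy.2] at hj
    omega
  obtain ⟨u, huS, hdis, hcov⟩ := Vitali.exists_disjoint_subfamily_covering_enlargement_closedBall
    S id (fun y => s (κ y)) (r / 2) (fun y _ => hsle _) 5 (by norm_num)
  have hdis' : u.PairwiseDisjoint fun y => ball y (s (κ y)) :=
    hdis.mono_on fun y _ => ball_subset_closedBall
  have hcount : u.Countable := hdis'.countable_of_isOpen (fun _ _ => isOpen_ball)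
    (fun y _ => nonempty_ball.2 (hs _))
  refine ⟨u, fun y => 6 * s (κ y), hcount, ?_, ?_, ?_⟩
  · intro y hy
    obtain ⟨j, hj, hPj⟩ := hκ1 y (huS hy)
    simp only [hj, hsucc]
    refine ⟨(huS hy).1, hs j, hsle j, ?_⟩
    have h1 := (mean_diff hg y (hs j) b).trans (not_lt.1 hPj)
    exact (ENNReal.mul_le_mul_iff_left (vol_pos y (hs j)) (vol_fin y _)).1 h1
  · have h6 : ∀ y : u, volume (ball (y : EuclideanSpace ℝ (Fin n)) (6 * s (κ y))) 
        = 6 ^ n * volume (ball (y : EuclideanSpace ℝ (Fin n)) (s (κ y))) := fun y => by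
      rw [vol_scale (y : EuclideanSpace ℝ (Fin n)) y (by norm_num : (0 : ℝ) < 6)]
      simp [ENNReal.ofReal_pow]
    simp only [h6]
    rw [ENNReal.tsum_mul_left]
    gcongr
    rw [ENNReal.le_div_iff_mul_le (Or.inl hlam) (Or.inl hlam'), mul_comm, ← ENNReal.tsum_mul_left]
    calc _ ≤ ∑' y : u, ∫⁻ z in ball (y : EuclideanSpace ℝ (Fin n)) (s (κ y)), ‖g z - b‖ₑ :=
          ENNReal.tsum_le_tsum fun y => (hκ y (huS y.2)).le
      _ = ∫⁻ z in ⋃ y ∈ u, ball y (s (κ y)), ‖g z - b‖ₑ :=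
          (lintegral_biUnion hcount (fun _ _ => measurableSet_ball) hdis' _).symm
      _ ≤ _ := (lintegral_mono_set 
          (Set.iUnion₂_subset fun y hy => hsub y (huS hy).1 _)).trans hI
  · filter_upwards [ae_le_of_avg hg b s hs hs0 lam] with y hy hyB
    apply hy
    by_contra! hk
    obtain ⟨z, hz, hsubz⟩ := hcov y ⟨hyB.1, hk⟩
    refine hyB.2 (Set.mem_biUnion hz ?_)
    have h1 := hsubz (mem_closedBall_self (hs _).le)
    refine closedBall_subset_ball ?_ h1
    have := hs (κ z)
    linarith

/-- The constant in the stopping argument. -/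
def Lc (n : ℕ) (p : ℝ) : ℝ := 2 ^ p * 6 ^ n * (2 ^ n * (1 + 2 ^ n))

lemma core_step {n : ℕ} {p : ℝ} (hp : 1 ≤ p) {g : EuclideanSpace ℝ (Fin n) → ℝ} 
    (hg : LocallyIntegrable g volume)
    (x₀ : EuclideanSpace ℝ (Fin n)) (r₀ : ℝ) {A : ℝ} (hA0 : 0 < A)
    (hA : ∀ y s, 0 < s → dist y x₀ + 2 * s ≤ 4 * r₀ → 
      ∫⁻ z in ball y s, ‖g z - ballAvg g y s‖ₑ ≤ ENNReal.ofReal A * volume (ball y s))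
    {N : ℝ≥0∞} (hN : ∀ y s, 0 < s → dist y x₀ + 2 * s ≤ 2 * r₀ → 
      ∫⁻ z in ball y s, ‖g z - ballAvg g y s‖ₑ ^ p ≤ N * volume (ball y s))
    (x : EuclideanSpace ℝ (Fin n)) {r : ℝ} (hr : 0 < r) (hxr : dist x x₀ + 2 * r ≤ 2 * r₀) :
    ∫⁻ z in ball x r, ‖g z - ballAvg g x r‖ₑ ^ p 
      ≤ (2 * ENNReal.ofReal (Lc n p * A) ^ p + N / 2) * volume (ball x r) := by
  have hd : 0 ≤ dist x x₀ := dist_nonneg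
  set b := ballAvg g x r
  set V := volume (ball x r) with hV
  have hV0 : V ≠ 0 := vol_pos x hr
  have hVf : V ≠ ⊤ := vol_fin x r
  set lam := ENNReal.ofReal (Lc n p * A) with hlam
  set I : ℝ≥0∞ := 2 ^ n * (1 + 2 ^ n) * ENNReal.ofReal A * V with hIdef
  have hp0 : 0 < p := by linarith
  have hlamI : 2 ^ p * 6 ^ n * I = lam * V := by
    rw [hIdef, hlam, Lc]
    have e1 : ENNReal.ofReal (2 ^ p * 6 ^ n * (2 ^ n * (1 + 2 ^ n)) * A) =
        2 ^ p * 6 ^ n * (2 ^ n * (1 + 2 ^ n)) * ENNReal.ofReal A := by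
      rw [ENNReal.ofReal_mul (by positivity), ENNReal.ofReal_mul (by positivity),
        ENNReal.ofReal_mul (by positivity), ENNReal.ofReal_mul (by positivity),
        ENNReal.ofReal_add (by positivity) (by positivity), ENNReal.ofReal_pow (by positivity),
        ENNReal.ofReal_pow (by positivity), ← ENNReal.ofReal_rpow_of_pos (by positivity)]
      simp
    rw [e1]; ring
  have hLpos : 0 < Lc n p * A := by unfold Lc; positivity
  have hlam0 : lam ≠ 0 := by simpa [hlam] using hLpos
  have hlamf : lam ≠ ⊤ := ENNReal.ofReal_ne_top
  have hIf : I ≠ ⊤ := by rw [hIdef]; finiteness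
  have h2p : (2 : ℝ≥0∞) ^ p = 2 * 2 ^ (p - 1) := by
    conv_lhs => rw [show p = 1 + (p - 1) by ring, 
      ENNReal.rpow_add _ _ (by norm_num) (by norm_num), ENNReal.rpow_one]
  have hI : ∫⁻ y in ball x (2 * r), ‖g y - b‖ₑ ≤ I :=
    double_bound hg x hr (hA x (2 * r) (by linarith) (by linarith))
  have hIl : 2 ^ n * I ≤ lam * V := by
    rw [← hlamI]
    gcongr
    calc (2 : ℝ≥0∞) ^ n ≤ 1 * 6 ^ n := by rw [one_mul]; gcongr; norm_num
      _ ≤ _ := by gcongr; exact ENNReal.one_le_rpow (by norm_num) hp0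
  obtain ⟨u, ρ, hc, hu, hsum, hae⟩ := stopping hg x hr b hlam0 hlamf hIf hI hIl
  have hU : MeasurableSet (⋃ z ∈ u, ball z (ρ z)) := 
    MeasurableSet.biUnion hc fun _ _ => measurableSet_ball
  have hm : AEMeasurable g volume := hg.aestronglyMeasurable.aemeasurable
  have hgood : ∫⁻ z in ball x r \ ⋃ z ∈ u, ball z (ρ z), ‖g z - b‖ₑ ^ p ≤ lam ^ p * V := by
    calc _ ≤ ∫⁻ z in ball x r \ ⋃ z ∈ u, ball z (ρ z), lam ^ p := by
          refine setLIntegral_mono_ae' (measurableSet_ball.diff hU) ?_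
          filter_upwards [hae] with z hz hzm
          gcongr
          exact hz hzm
      _ ≤ _ := by
          rw [setLIntegral_const]
          gcongr
          exact measure_mono Set.sdiff_subset
  have hbad : ∀ y ∈ u, ∫⁻ z in ball y (ρ y), ‖g z - b‖ₑ ^ p 
      ≤ 2 ^ (p - 1) * (N + lam ^ p) * volume (ball y (ρ y)) := by
    intro y hy
    obtain ⟨hyB, hρ, hρ2, hm'⟩ := hu y hy
    have hyx := mem_ball.1 hyB
    have hNy := hN y (ρ y) hρ (by have := dist_triangle y x x₀; linarith)
    calc ∫⁻ z in ball y (ρ y), ‖g z - b‖ₑ ^ p 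
        ≤ ∫⁻ z in ball y (ρ y), 2 ^ (p - 1) * (‖g z - ballAvg g y (ρ y)‖ₑ ^ p + lam ^ p) := by
          refine lintegral_mono fun z => ?_
          refine le_trans ?_ (ENNReal.rpow_add_le_mul_rpow_add_rpow _ _ hp)
          gcongr
          calc ‖g z - b‖ₑ = ‖(g z - ballAvg g y (ρ y)) + (ballAvg g y (ρ y) - b)‖ₑ := by
                congr 1; ring
            _ ≤ _ := (enorm_add_le _ _).trans (by gcongr)
      _ = 2 ^ (p - 1) * ((∫⁻ z in ball y (ρ y), ‖g z - ballAvg g y (ρ y)‖ₑ ^ p) + 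
            lam ^ p * volume (ball y (ρ y))) := by
          rw [lintegral_const_mul' _ _ (by finiteness), lintegral_add_right _ measurable_const]
          simp
      _ ≤ 2 ^ (p - 1) * (N * volume (ball y (ρ y)) + lam ^ p * volume (ball y (ρ y))) := by
          gcongr
      _ = _ := by ring
  have hhalf : 2 ^ (p - 1) * (6 ^ n * (I / lam)) = V / 2 := by
    rw [ENNReal.eq_div_iff (by norm_num) (by norm_num)]
    calc _ = 2 * 2 ^ (p - 1) * 6 ^ n * I / lam := by
          simp only [div_eq_mul_inv]; ring
      _ = V := by
          rw [← h2p, hlamI, mul_comm, ENNReal.mul_div_cancel_right hlam0 hlamf]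
  calc ∫⁻ z in ball x r, ‖g z - b‖ₑ ^ p 
      ≤ ∫⁻ z in (ball x r \ ⋃ z ∈ u, ball z (ρ z)) ∪ ⋃ z ∈ u, ball z (ρ z), ‖g z - b‖ₑ ^ p :=
        lintegral_mono_set (by intro z hz; by_cases h : z ∈ ⋃ z ∈ u, ball z (ρ z)
                               · exact Or.inr h
                               · exact Or.inl ⟨hz, h⟩)
    _ ≤ _ := lintegral_union_le _ _ _
    _ ≤ lam ^ p * V + ∑' y : u, 2 ^ (p - 1) * (N + lam ^ p) * volume (ball (y : EuclideanSpace ℝ (Fin n)) (ρ y)) := by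
        gcongr
        have := hc.to_subtype
        rw [Set.biUnion_eq_iUnion]
        refine (lintegral_iUnion_le _ _).trans ?_
        exact ENNReal.tsum_le_tsum fun y => hbad y y.2
    _ ≤ lam ^ p * V + 2 ^ (p - 1) * (N + lam ^ p) * (6 ^ n * (I / lam)) := by
        rw [ENNReal.tsum_mul_left]; gcongr
    _ = lam ^ p * V + (N + lam ^ p) * (V / 2) := by rw [← hhalf]; ring
    _ ≤ _ := by
        have : (N + lam ^ p) * (V / 2) = N / 2 * V + lam ^ p * (V / 2) := by
          simp only [div_eq_mul_inv]; ring
        rw [this]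
        have h3 : V / 2 ≤ V := ENNReal.half_le_self
        calc _ ≤ lam ^ p * V + (N / 2 * V + lam ^ p * V) := by gcongr
          _ = _ := by ring

lemma core_bdd {n : ℕ} {p : ℝ} (hp : 1 ≤ p) {g : EuclideanSpace ℝ (Fin n) → ℝ} 
    (hg : LocallyIntegrable g volume) {M : ℝ≥0} (hM : ∀ y, ‖g y‖ₑ ≤ M)
    (x₀ : EuclideanSpace ℝ (Fin n)) {r₀ : ℝ} (hr₀ : 0 < r₀) {A : ℝ} (hA0 : 0 < A)
    (hA : ∀ y s, 0 < s → dist y x₀ + 2 * s ≤ 4 * r₀ → 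
      ∫⁻ z in ball y s, ‖g z - ballAvg g y s‖ₑ ≤ ENNReal.ofReal A * volume (ball y s)) :
    ∫⁻ z in ball x₀ r₀, ‖g z - ballAvg g x₀ r₀‖ₑ ^ p 
      ≤ 4 * ENNReal.ofReal (Lc n p * A) ^ p * volume (ball x₀ r₀) := by
  set T := 2 * ENNReal.ofReal (Lc n p * A) ^ p
  let N : ℝ≥0∞ := ⨆ (y : EuclideanSpace ℝ (Fin n)) (s : ℝ) (_ : 0 < s) 
    (_ : dist y x₀ + 2 * s ≤ 2 * r₀),
    (∫⁻ z in ball y s, ‖g z - ballAvg g y s‖ₑ ^ p) / volume (ball y s)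
  have hN : ∀ y s, 0 < s → dist y x₀ + 2 * s ≤ 2 * r₀ → 
      ∫⁻ z in ball y s, ‖g z - ballAvg g y s‖ₑ ^ p ≤ N * volume (ball y s) := by
    intro y s hs hys
    rw [← ENNReal.div_le_iff (vol_pos y hs) (vol_fin y s)]
    exact le_iSup_of_le y (le_iSup_of_le s (le_iSup_of_le hs (le_iSup_of_le hys le_rfl)))
  have hNf : N ≤ (2 * (M : ℝ≥0∞)) ^ p := by
    refine iSup_le fun y => iSup_le fun s => iSup_le fun hs => iSup_le fun _ => ?_
    rw [ENNReal.div_le_iff (vol_pos y hs) (vol_fin y s)]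
    have hav : ‖ballAvg g y s‖ₑ ≤ M := by
      have h1 := mean_diff hg y hs 0
      simp only [sub_zero] at h1
      have h2 : ∫⁻ z in ball y s, ‖g z‖ₑ ≤ M * volume (ball y s) := 
        (lintegral_mono hM).trans (by simp)
      exact (ENNReal.mul_le_mul_iff_left (vol_pos y hs) (vol_fin y _)).1 (h1.trans h2)
    calc _ ≤ ∫⁻ z in ball y s, (2 * (M : ℝ≥0∞)) ^ p := by
          refine lintegral_mono fun z => ?_
          have : ‖g z - ballAvg g y s‖ₑ ≤ 2 * M := 
            enorm_sub_le.trans (by rw [two_mul]; exact add_le_add (hM z) hav)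
          exact ENNReal.rpow_le_rpow this (by linarith)
      _ = _ := by simp
  have hp0 : 0 ≤ p := by linarith
  have hNt : N ≠ ⊤ := ne_top_of_le_ne_top 
    (ENNReal.rpow_ne_top_of_nonneg hp0 (by finiteness)) hNf
  have hstep : N ≤ T + N / 2 := by
    refine iSup_le fun y => iSup_le fun s => iSup_le fun hs => iSup_le fun hys => ?_
    rw [ENNReal.div_le_iff (vol_pos y hs) (vol_fin y s)]
    exact core_step hp hg x₀ r₀ hA0 hA hN y hs hys
  have hhalf : N / 2 ≤ T := by
    have h1 : N / 2 + N / 2 ≤ T + N / 2 := by rwa [ENNReal.add_halves]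
    exact (ENNReal.add_le_add_iff_right (by finiteness)).1 h1
  refine (hN x₀ r₀ hr₀ (by simp)).trans ?_
  gcongr
  calc N = N / 2 + N / 2 := (ENNReal.add_halves N).symm
    _ ≤ T + T := by gcongr
    _ = _ := by simp only [T]; ring

/-- Truncation. -/
def trunc (M t : ℝ) : ℝ := max (-M) (min t M)

lemma trunc_lip (M s t : ℝ) : |trunc M s - trunc M t| ≤ |s - t| := by
  unfold trunc
  refine (abs_max_sub_max_le_max _ _ _ _).trans ?_
  refine max_le (by simp) ((abs_min_sub_min_le_max _ _ _ _).trans (by simp))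

lemma trunc_abs {M : ℝ} (hM : 0 ≤ M) (t : ℝ) : |trunc M t| ≤ |t| := by
  have := trunc_lip M t 0
  simpa [trunc, hM] using this

lemma trunc_bd {M : ℝ} (hM : 0 ≤ M) (t : ℝ) : |trunc M t| ≤ M := by
  unfold trunc
  rw [abs_le]
  exact ⟨le_max_left _ _, max_le (by linarith) (min_le_right _ _)⟩

lemma trunc_cont (M : ℝ) : Continuous (trunc M) := by unfold trunc; fun_prop

lemma trunc_eq {M t : ℝ} (h : |t| ≤ M) : trunc M t = t := by
  have := abs_le.1 h
  unfold trunc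
  rw [min_eq_left this.2, max_eq_right this.1]

lemma core_full {n : ℕ} {p : ℝ} (hp : 1 ≤ p) {f : EuclideanSpace ℝ (Fin n) → ℝ} 
    (hf : LocallyIntegrable f volume) 
    (x₀ : EuclideanSpace ℝ (Fin n)) {r₀ : ℝ} (hr₀ : 0 < r₀) {A : ℝ} (hA0 : 0 < A)
    (hA : ∀ y s, 0 < s → dist y x₀ + 2 * s ≤ 4 * r₀ → 
      ∫⁻ z in ball y s, ‖f z - ballAvg f y s‖ₑ ≤ ENNReal.ofReal A * volume (ball y s)) :
    ∫⁻ z in ball x₀ r₀, ‖f z - ballAvg f x₀ r₀‖ₑ ^ p 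
      ≤ 4 * ENNReal.ofReal (Lc n p * (2 * A)) ^ p * volume (ball x₀ r₀) := by
  have hp0 : 0 ≤ p := by linarith
  let g : ℕ → EuclideanSpace ℝ (Fin n) → ℝ := fun M y => trunc M (f y)
  have hgm : ∀ M, AEStronglyMeasurable (g M) volume := fun M =>
    (trunc_cont M).comp_aestronglyMeasurable hf.aestronglyMeasurable
  have hg : ∀ M, LocallyIntegrable (g M) volume := fun M =>
    hf.mono (hgm M) (Eventually.of_forall fun y => trunc_abs (Nat.cast_nonneg M) (f y))
  have hgA : ∀ M : ℕ, ∀ y s, 0 < s → dist y x₀ + 2 * s ≤ 4 * r₀ → 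
      ∫⁻ z in ball y s, ‖g M z - ballAvg (g M) y s‖ₑ 
        ≤ ENNReal.ofReal (2 * A) * volume (ball y s) := by
    intro M y s hs hys
    refine (osc_le (hg M) y hs (trunc M (ballAvg f y s))).trans ?_
    rw [ENNReal.ofReal_mul (by norm_num), mul_assoc]
    simp only [ENNReal.ofReal_ofNat]
    gcongr
    refine le_trans (lintegral_mono fun z => ?_) (hA y s hs hys)
    rw [enorm_le_iff_norm_le]
    exact trunc_lip _ _ _
  have hbd : ∀ M : ℕ, ∫⁻ z in ball x₀ r₀, ‖g M z - ballAvg (g M) x₀ r₀‖ₑ ^ p 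
      ≤ 4 * ENNReal.ofReal (Lc n p * (2 * A)) ^ p * volume (ball x₀ r₀) := fun M => by
    refine core_bdd hp (hg M) (M := M) (fun y => ?_) x₀ hr₀ (by linarith) (hgA M)
    have := trunc_bd (Nat.cast_nonneg M) (f y)
    rw [← ofReal_norm]
    refine (ENNReal.ofReal_le_ofReal this).trans (by simp)
  have hpt : ∀ y, Tendsto (fun M => g M y) atTop (nhds (f y)) := fun y => by
    refine tendsto_const_nhds.congr' ?_
    obtain ⟨K, hK⟩ := exists_nat_ge |f y|
    filter_upwards [eventually_ge_atTop K] with M hM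
    exact (trunc_eq (hK.trans (by exact_mod_cast hM))).symm
  have havg : Tendsto (fun M => ballAvg (g M) x₀ r₀) atTop (nhds (ballAvg f x₀ r₀)) := by
    unfold ballAvg
    refine Tendsto.const_mul _ ?_
    refine tendsto_integral_of_dominated_convergence (fun y => |f y|) 
      (fun M => (hgm M).restrict) (intOn_ball hf x₀ r₀).norm ?_ (Eventually.of_forall hpt)
    exact fun M => Eventually.of_forall fun y => trunc_abs (Nat.cast_nonneg M) (f y)
  have hlim : ∀ y, Tendsto (fun M => ‖g M y - ballAvg (g M) x₀ r₀‖ₑ ^ p) atTop 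
      (nhds (‖f y - ballAvg f x₀ r₀‖ₑ ^ p)) := fun y =>
    ((hpt y).sub havg).enorm.ennrpow_const p
  calc _ = ∫⁻ z in ball x₀ r₀, liminf (fun M => ‖g M z - ballAvg (g M) x₀ r₀‖ₑ ^ p) atTop := by
        refine lintegral_congr fun z => ((hlim z).liminf_eq).symm
    _ ≤ liminf (fun M => ∫⁻ z in ball x₀ r₀, ‖g M z - ballAvg (g M) x₀ r₀‖ₑ ^ p) atTop := by
        refine lintegral_liminf_le' fun M => ?_
        exact ((hgm M).restrict.sub aestronglyMeasurable_const).enorm.pow_const p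
    _ ≤ _ := by
        refine (liminf_le_liminf (Eventually.of_forall hbd)).trans ?_
        simp

lemma semi_one_le {n : ℕ} {p : ℝ} (hp : 1 ≤ p)
    {φ : EuclideanSpace ℝ (Fin n) → ℝ → ℝ} (hpos : GrowthPos φ)
    {f : EuclideanSpace ℝ (Fin n) → ℝ} (hf : MemLpLoc p f) :
    campSemi 1 φ f ≤ campSemi p φ f := by
  unfold campSemi
  refine iSup_mono fun x => iSup_mono fun r => iSup_mono fun hr => ?_
  have := hpos x r hr
  have hp0 : 0 < p := by linarith
  refine ENNReal.ofReal_le_ofReal ?_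
  gcongr
  simp only [Real.rpow_one, div_one]
  set b := ballAvg f x r
  have hm : AEStronglyMeasurable f (volume.restrict (ball x r)) := hf.1.aestronglyMeasurable.restrict
  have hfin : IsFiniteMeasure (volume.restrict (ball x r)) := ⟨by simpa using (vol_fin x r).lt_top⟩
  have hP0 : ENNReal.ofReal p ≠ 0 := by simpa using hp0
  have hPr : (ENNReal.ofReal p).toReal = p := ENNReal.toReal_ofReal hp0.le
  have hL : MemLp f (ENNReal.ofReal p) (volume.restrict (ball x r)) := by
    rw [← integrable_norm_rpow_iff hm hP0 ENNReal.ofReal_ne_top, hPr]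
    exact hf.2 x r hr
  have hL2 : MemLp (fun y => f y - b) (ENNReal.ofReal p) (volume.restrict (ball x r)) :=
    hL.sub (memLp_const b)
  have hi : IntegrableOn (fun y => |f y - b| ^ p) (ball x r) volume := by
    have := (integrable_norm_rpow_iff hL2.1 hP0 ENNReal.ofReal_ne_top).2 hL2
    rwa [hPr] at this
  have hi1 : IntegrableOn (fun y => |f y - b|) (ball x r) volume :=
    ((intOn_ball hf.1 x r).sub (integrableOn_const (vol_fin x r))).abs
  have hJ := (convexOn_rpow hp).map_set_average_le (μ := volume) (t := ball x r) 
    (f := fun y => |f y - b|)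
    (fun t _ => (Real.continuousAt_rpow_const t p (Or.inr hp0.le)).continuousWithinAt) isClosed_Ici
    (vol_pos x hr) (vol_fin x r) (Eventually.of_forall fun y => Set.mem_Ici.2 (abs_nonneg _)) hi1 hi
  simp only [setAverage_eq, smul_eq_mul, Measure.real] at hJ
  have h0 : 0 ≤ (volume (ball x r)).toReal⁻¹ * ∫ y in ball x r, |f y - b| := 
    mul_nonneg (by positivity) (integral_nonneg fun _ => abs_nonneg _)
  have := Real.rpow_le_rpow (Real.rpow_nonneg h0 p) hJ (by positivity : 0 ≤ 1 / p)
  rwa [← Real.rpow_mul h0, mul_one_div_cancel hp0.ne', Real.rpow_one] at this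

lemma semi_p_le {n : ℕ} {p : ℝ} (hp : 1 ≤ p)
    {φ : EuclideanSpace ℝ (Fin n) → ℝ → ℝ} (hpos : GrowthPos φ) {D : ℝ} (hD0 : 0 < D)
    (hφ : ∀ x r, 0 < r → ∀ y s, 0 < s → dist y x + 2 * s ≤ 4 * r → φ y s ≤ D * φ x r)
    {f : EuclideanSpace ℝ (Fin n) → ℝ} (hf : LocallyIntegrable f volume) :
    campSemi p φ f ≤ ENNReal.ofReal (8 * Lc n p * D) * campSemi 1 φ f := by
  have hp0 : 0 < p := by linarith
  have hL0 : 0 < Lc n p := by unfold Lc; positivity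
  by_cases htop : campSemi 1 φ f = ⊤
  · rw [htop, ENNReal.mul_top (by simpa using by positivity)]; exact le_top
  set a := (campSemi 1 φ f).toReal with ha
  have ha0 : 0 ≤ a := ENNReal.toReal_nonneg
  rw [← ENNReal.ofReal_toReal htop, ← ENNReal.ofReal_mul (by positivity), ← ha]
  have hosc : ∀ y s, 0 < s → ∫⁻ z in ball y s, ‖f z - ballAvg f y s‖ₑ 
      ≤ ENNReal.ofReal (a * φ y s) * volume (ball y s) := by
    intro y s hs
    have hV := ENNReal.toReal_pos (vol_pos y hs) (vol_fin y s)
    have hφ0 := hpos y s hs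
    have h1 : ENNReal.ofReal ((φ y s)⁻¹ *
      ((volume (ball y s)).toReal⁻¹ * ∫ z in ball y s, |f z - ballAvg f y s| ^ (1 : ℝ)) ^ (1 / (1 : ℝ)))
        ≤ campSemi 1 φ f :=
      le_iSup_of_le y (le_iSup_of_le s (le_iSup_of_le hs le_rfl))
    rw [← ENNReal.ofReal_toReal htop, ENNReal.ofReal_le_ofReal_iff ha0] at h1
    simp only [Real.rpow_one, div_one] at h1
    rw [inv_mul_le_iff₀ hφ0, inv_mul_le_iff₀ hV] at h1
    have hi : Integrable (fun z => f z - ballAvg f y s) (volume.restrict (ball y s)) :=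
      (intOn_ball hf y s).sub (integrableOn_const (vol_fin y s))
    rw [← ofReal_integral_norm_eq_lintegral_enorm hi]
    refine (ENNReal.ofReal_le_ofReal h1).trans (le_of_eq ?_)
    rw [ENNReal.ofReal_mul hV.le, ENNReal.ofReal_toReal (vol_fin y s), mul_comm, mul_comm (φ y s)]
  unfold campSemi
  refine iSup_le fun x => iSup_le fun r => iSup_le fun hr => ENNReal.ofReal_le_ofReal ?_
  have hV := ENNReal.toReal_pos (vol_pos x hr) (vol_fin x r)
  have hφ0 := hpos x r hr
  have key : ∀ a', a < a' → (φ x r)⁻¹ *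
      ((volume (ball x r)).toReal⁻¹ * ∫ y in ball x r, |f y - ballAvg f x r| ^ p) ^ (1 / p) 
        ≤ 8 * Lc n p * D * a' := by
    intro a' haa
    have ha' : 0 < a' := by linarith
    set A := a' * (D * φ x r) with hAdef
    have hA0 : 0 < A := by positivity
    have hc := core_full hp hf x hr hA0 (fun y s hs hys => (hosc y s hs).trans (by
      have h1 := hφ x r hr y s hs hys
      have h2 := hpos y s hs
      gcongr
      rw [hAdef]
      gcongr))
    have hint : ∫ y in ball x r, |f y - ballAvg f x r| ^ p 
        ≤ 4 * (Lc n p * (2 * A)) ^ p * (volume (ball x r)).toReal := by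
      have hmeas : AEStronglyMeasurable (fun y => |f y - ballAvg f x r| ^ p) 
          (volume.restrict (ball x r)) :=
        ((hf.aestronglyMeasurable.restrict.sub 
          aestronglyMeasurable_const).norm.aemeasurable.pow_const p).aestronglyMeasurable
      rw [integral_eq_lintegral_of_nonneg_ae (Eventually.of_forall fun y => by positivity) hmeas]
      refine ENNReal.toReal_le_of_le_ofReal (by positivity) ?_
      rw [ENNReal.ofReal_mul (by positivity), ENNReal.ofReal_mul (by positivity), 
        ENNReal.ofReal_toReal (vol_fin x r), ← ENNReal.ofReal_rpow_of_pos (by positivity)]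
      refine le_trans (le_of_eq ?_) (hc.trans (by simp))
      refine lintegral_congr fun y => ?_
      rw [← ENNReal.ofReal_rpow_of_nonneg (abs_nonneg _) hp0.le, ← Real.norm_eq_abs, ofReal_norm]
    have h2 : (volume (ball x r)).toReal⁻¹ * ∫ y in ball x r, |f y - ballAvg f x r| ^ p 
        ≤ 4 * (Lc n p * (2 * A)) ^ p := by
      rw [inv_mul_le_iff₀ hV]; linarith
    have h0 : 0 ≤ (volume (ball x r)).toReal⁻¹ * ∫ y in ball x r, |f y - ballAvg f x r| ^ p :=
      mul_nonneg (by positivity) (integral_nonneg fun y => by positivity)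
    have h3 := Real.rpow_le_rpow h0 h2 (by positivity : 0 ≤ 1 / p)
    rw [Real.mul_rpow (x := 4) (by norm_num) (by positivity), ← Real.rpow_mul (by positivity), 
      mul_one_div_cancel hp0.ne', Real.rpow_one] at h3
    have h4 : (4 : ℝ) ^ (1 / p) ≤ 4 := by
      calc (4 : ℝ) ^ (1 / p) ≤ 4 ^ (1 : ℝ) := 
            Real.rpow_le_rpow_of_exponent_le (by norm_num) (by rw [div_le_one hp0]; exact hp)
        _ = 4 := Real.rpow_one _
    rw [inv_mul_le_iff₀ hφ0]
    calc _ ≤ _ := h3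
      _ ≤ 4 * (Lc n p * (2 * A)) := by gcongr
      _ = _ := by rw [hAdef]; ring
  have hK : 0 < 8 * Lc n p * D := by positivity
  rw [← div_le_iff₀' hK]
  refine le_of_forall_gt_imp_ge_of_dense fun a' haa => ?_
  rw [div_le_iff₀' hK]
  exact key a' haa

/-- If `φ` satisfies (D), (N) and (I), then for every `1 ≤ p < ∞` the
Campanato spaces for exponents `p` and `1` coincide with equivalent (semi)norms. -/
theorem campanato_p_eq_campanato_one (n : ℕ) (p : ℝ) (hp : 1 ≤ p)
    (φ : EuclideanSpace ℝ (Fin n) → ℝ → ℝ) (hpos : GrowthPos φ)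
    (hD : Doubling φ) (hN : Nearness φ) (hI : AlmostIncreasing φ) :
    ∃ C > 0, ∀ f : EuclideanSpace ℝ (Fin n) → ℝ, MemLpLoc p f →
      (ENNReal.ofReal C⁻¹ * campSemi 1 φ f ≤ campSemi p φ f ∧
        campSemi p φ f ≤ ENNReal.ofReal C * campSemi 1 φ f) ∧
      (ENNReal.ofReal C⁻¹ * campNorm 1 φ f ≤ campNorm p φ f ∧
        campNorm p φ f ≤ ENNReal.ofReal C * campNorm 1 φ f) := by
  obtain ⟨A₁, hA₁, hD⟩ := hD
  obtain ⟨A₂, hA₂, hN⟩ := hN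
  obtain ⟨A₃, hA₃, hI⟩ := hI
  set D := A₃ * A₂ * A₁ ^ 2 with hDdef
  have hD0 : 0 < D := by positivity
  have hL0 : 0 < Lc n p := by unfold Lc; positivity
  have hφ : ∀ x r, 0 < r → ∀ y s, 0 < s → dist y x + 2 * s ≤ 4 * r → φ y s ≤ D * φ x r := by
    intro x r hr y s hs hys
    have hd : 0 ≤ dist y x := dist_nonneg
    have h1 := hI y s (4 * r) hs (by linarith)
    have h2 := (hN y x (4 * r) (by linarith) (by linarith)).2
    rw [div_le_iff₀ (hpos _ _ (by linarith))] at h2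
    have h3 := (hD x (2 * r) (4 * r) (by linarith) (by linarith) 
      (by rw [div_le_div_iff₀] <;> linarith) (by rw [div_le_iff₀] <;> linarith)).2
    rw [div_le_iff₀ (hpos _ _ (by linarith))] at h3
    have h4 := (hD x r (2 * r) (by linarith) (by linarith) 
      (by rw [div_le_div_iff₀] <;> linarith) (by rw [div_le_iff₀] <;> linarith)).2
    rw [div_le_iff₀ (hpos _ _ (by linarith))] at h4
    calc φ y s ≤ A₃ * φ y (4 * r) := h1
      _ ≤ A₃ * (A₂ * (A₁ * (A₁ * φ x r))) := by
        gcongr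
        exact h2.trans (by gcongr; exact h3.trans (by gcongr))
      _ = _ := by rw [hDdef]; ring
  set C := max 1 (8 * Lc n p * D) with hC
  have hC1 : 1 ≤ C := le_max_left _ _
  have hCi : ENNReal.ofReal C⁻¹ ≤ 1 := by
    rw [ENNReal.ofReal_le_one]; exact inv_le_one_of_one_le₀ hC1
  have hCo : 1 ≤ ENNReal.ofReal C := by rwa [ENNReal.one_le_ofReal]
  refine ⟨C, by positivity, fun f hf => ?_⟩
  have hlow : campSemi 1 φ f ≤ campSemi p φ f := semi_one_le hp hpos hf
  have hupp : campSemi p φ f ≤ ENNReal.ofReal C * campSemi 1 φ f :=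
    (semi_p_le hp hpos hD0 hφ hf.1).trans (by gcongr; exact le_max_right _ _)
  have hlow' : ENNReal.ofReal C⁻¹ * campSemi 1 φ f ≤ campSemi p φ f :=
    (mul_le_of_le_one_left zero_le hCi).trans hlow
  refine ⟨⟨hlow', hupp⟩, ?_, ?_⟩
  · exact (mul_le_of_le_one_left zero_le hCi).trans (by unfold campNorm; gcongr)
  · unfold campNorm
    rw [mul_add]
    gcongr
    exact le_mul_of_one_le_left zero_le hCo


end
end

section
/- Let φ : ℝⁿ × (0,∞) → (0,∞) satisfy conditions (D), (N), (I), and assume there is C₀ > 0 with ∫₀^r φ(x,t)/t dt ≤ C₀ φ(x,r) for all x ∈ ℝⁿ and r > 0. Then for every 1 ≤ p < ∞: every f with ‖f‖_{𝓛_{p,φ}} < ∞ coincides almost everywhere with a continuous function f̃, and there is a constant C > 0 (independent of f) such that C⁻¹‖f̃‖_{Λ_φ} ≤ ‖f‖_{𝓛_{p,φ}} ≤ C‖f̃‖_{Λ_φ}; conversely every continuous g with ‖g‖_{Λ_φ} < ∞ satisfies ‖g‖_{𝓛_{p,φ}} ≤ C‖g‖_{Λ_φ}. In particular the spaces 𝓛_{p,φ}(ℝⁿ)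 and Λ_φ(ℝⁿ) coincide (modulo null functions) with equivalent seminorms, and for φ(x,r) = r^α with 0 < α ≤ 1 one obtains 𝓛_{p,φ}(ℝⁿ) = Lip_α(ℝⁿ). -/
open MeasureTheory Metric Filter
open scoped ENNReal NNReal

noncomputable section

section helpers
variable {n : ℕ}

lemma aux_vol_pos (x : EuclideanSpace ℝ (Fin n)) {r : ℝ} (hr : 0 < r) :
    0 < (volume (ball x r)).toReal :=
  ENNReal.toReal_pos (measure_ball_pos volume x hr).ne' measure_ball_lt_top.ne

lemma aux_vol_le (x y : EuclideanSpace ℝ (Fin n)) {r s : ℝ} (hr : 0 < r) (hs : 0 < s)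
    (h : r ≤ 2 * s) :
    (volume (ball x r)).toReal ≤ 2 ^ n * (volume (ball y s)).toReal := by
  rw [Measure.addHaar_ball_of_pos volume x hr, Measure.addHaar_ball_of_pos volume y hs,
    finrank_euclideanSpace_fin, ENNReal.toReal_mul, ENNReal.toReal_mul,
    ENNReal.toReal_ofReal (by positivity), ENNReal.toReal_ofReal (by positivity),
    ← mul_assoc, ← mul_pow]
  gcongr

lemma aux_intOn {f : EuclideanSpace ℝ (Fin n) → ℝ} (hf : LocallyIntegrable f volume)
    (x : EuclideanSpace ℝ (Fin n)) (r : ℝ) : IntegrableOn f (ball x r) volume :=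
  (hf.integrableOn_isCompact (isCompact_closedBall x r)).mono_set ball_subset_closedBall

lemma aux_avg_sub {f : EuclideanSpace ℝ (Fin n) → ℝ} (y : EuclideanSpace ℝ (Fin n)) {s : ℝ}
    (hs : 0 < s) (hf : IntegrableOn f (ball y s) volume) (c : ℝ) :
    |ballAvg f y s - c| ≤ (volume (ball y s)).toReal⁻¹ * ∫ z in ball y s, |f z - c| := by
  have hv := aux_vol_pos y hs
  have h1 : ∫ z in ball y s, (f z - c) = (∫ z in ball y s, f z) - (volume (ball y s)).toReal * c := by
    rw [integral_sub hf (integrableOn_const (C := c) measure_ball_lt_top.ne)]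
    simp [Measure.real]
  have h2 : ballAvg f y s - c = (volume (ball y s)).toReal⁻¹ * ∫ z in ball y s, (f z - c) := by
    rw [h1, ballAvg]; field_simp
  rw [h2, abs_mul, abs_of_pos (inv_pos.2 hv)]
  gcongr
  exact abs_integral_le_integral_abs

lemma aux_avg_diff {f : EuclideanSpace ℝ (Fin n) → ℝ} (hf : LocallyIntegrable f volume)
    (x y : EuclideanSpace ℝ (Fin n)) {r s K : ℝ} (hr : 0 < r) (hs : 0 < s) (h : r ≤ 2 * s)
    (hsub : ball y s ⊆ ball x r)
    (hK : (volume (ball x r)).toReal⁻¹ * ∫ z in ball x r, |f z - ballAvg f x r| ≤ K) :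
    |ballAvg f y s - ballAvg f x r| ≤ 2 ^ n * K := by
  refine (aux_avg_sub y hs (aux_intOn hf y s) _).trans ?_
  have hx := aux_vol_pos x hr
  have hy := aux_vol_pos y hs
  have hv := aux_vol_le x y hr hs h
  have hmono : ∫ z in ball y s, |f z - ballAvg f x r| ≤ ∫ z in ball x r, |f z - ballAvg f x r| := by
    refine setIntegral_mono_set ?_ (Eventually.of_forall fun _ => abs_nonneg _)
      (LE.le.eventuallyLE hsub)
    exact ((aux_intOn hf x r).sub (integrableOn_const measure_ball_lt_top.ne)).abs
  have h0 : 0 ≤ ∫ z in ball x r, |f z - ballAvg f x r| := integral_nonneg fun _ => abs_nonneg _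
  have hinv : (volume (ball y s)).toReal⁻¹ ≤ 2 ^ n * (volume (ball x r)).toReal⁻¹ := by
    rw [inv_le_iff_one_le_mul₀ hy]
    have : 1 ≤ (2 ^ n * (volume (ball y s)).toReal) / (volume (ball x r)).toReal :=
      (one_le_div hx).2 hv
    calc _ ≤ _ := this
      _ = _ := by field_simp
  calc _ ≤ (2 ^ n * (volume (ball x r)).toReal⁻¹) * ∫ z in ball x r, |f z - ballAvg f x r| :=
        mul_le_mul hinv hmono (integral_nonneg fun _ => abs_nonneg _) (by positivity)
    _ = 2 ^ n * ((volume (ball x r)).toReal⁻¹ * ∫ z in ball x r, |f z - ballAvg f x r|) := by ring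
    _ ≤ _ := by gcongr

lemma aux_jensen {p : ℝ} (hp : 1 ≤ p) {f : EuclideanSpace ℝ (Fin n) → ℝ} (hf : MemLpLoc p f)
    (x : EuclideanSpace ℝ (Fin n)) {r : ℝ} (hr : 0 < r) (c : ℝ) :
    (volume (ball x r)).toReal⁻¹ * ∫ z in ball x r, |f z - c| ≤
      ((volume (ball x r)).toReal⁻¹ * ∫ z in ball x r, |f z - c| ^ p) ^ (1 / p) := by
  have hp0 : 0 < p := by linarith
  have hint := aux_intOn hf.1 x r
  have hp0' : ENNReal.ofReal p ≠ 0 := by simpa using hp0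
  have hL : MemLp f (ENNReal.ofReal p) (volume.restrict (ball x r)) := by
    rw [← integrable_norm_rpow_iff hint.aestronglyMeasurable hp0' ENNReal.ofReal_ne_top,
      ENNReal.toReal_ofReal hp0.le]
    exact hf.2 x r hr
  have : IsFiniteMeasure (volume.restrict (ball x r)) :=
    ⟨by simpa using measure_ball_lt_top⟩
  have hL2 : MemLp (fun z => f z - c) (ENNReal.ofReal p) (volume.restrict (ball x r)) :=
    hL.sub (memLp_const c)
  have hI2 := (integrable_norm_rpow_iff hL2.1 hp0' ENNReal.ofReal_ne_top).2 hL2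
  rw [ENNReal.toReal_ofReal hp0.le] at hI2
  have hJ := (convexOn_rpow hp).map_set_average_le (μ := volume) (t := ball x r)
    (f := fun z => |f z - c|) (Real.continuous_rpow_const hp0.le).continuousOn isClosed_Ici
    (measure_ball_pos volume x hr).ne' measure_ball_lt_top.ne
    (Eventually.of_forall fun z => Set.mem_Ici.2 (abs_nonneg (f z - c)))
    ((hint.sub (integrableOn_const measure_ball_lt_top.ne)).abs) hI2
  rw [setAverage_eq, setAverage_eq, smul_eq_mul, smul_eq_mul] at hJ
  have h0 : 0 ≤ (volume (ball x r)).toReal⁻¹ * ∫ z in ball x r, |f z - c| :=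
    mul_nonneg (by positivity) (integral_nonneg fun _ => abs_nonneg _)
  have := Real.rpow_le_rpow (Real.rpow_nonneg h0 p) hJ (by positivity : 0 ≤ 1 / p)
  rwa [← Real.rpow_mul h0, mul_one_div_cancel hp0.ne', Real.rpow_one] at this

lemma aux_piece {A : ℝ} (hA : 0 < A) {φ : EuclideanSpace ℝ (Fin n) → ℝ → ℝ} (hpos : GrowthPos φ)
    (hD : DoublingWith A φ) (x : EuclideanSpace ℝ (Fin n)) {r : ℝ} (hr : 0 < r)
    (hi : IntervalIntegrable (fun t => φ x t / t) volume (r / 2) r) :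
    φ x r ≤ 2 * A * ∫ t in (r / 2)..r, φ x t / t := by
  have h := intervalIntegral.integral_mono_on (f := fun _ => φ x r / (A * r)) (by linarith)
    intervalIntegrable_const hi (fun t ht => by
      have ht0 : 0 < t := by linarith [ht.1]
      have h1 := (hD x t r ht0 hr (by rw [le_div_iff₀ ht0]; linarith [ht.2])
        (by rw [div_le_iff₀ ht0]; linarith [ht.1])).2
      rw [div_le_iff₀ (hpos x t ht0)] at h1
      have h2 : φ x r / (A * r) = (φ x r / A) / r := by field_simp
      rw [h2]
      have h3 : φ x r / A ≤ φ x t := by rw [div_le_iff₀ hA]; linarith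
      have := hpos x t ht0
      exact div_le_div₀ this.le h3 ht0 ht.2)
  rw [intervalIntegral.integral_const, smul_eq_mul] at h
  have h4 : (r - r / 2) * (φ x r / (A * r)) = φ x r / (2 * A) := by field_simp; ring
  rw [h4, div_le_iff₀ (by positivity)] at h
  linarith

lemma aux_sum {A : ℝ} (hA : 0 < A) {φ : EuclideanSpace ℝ (Fin n) → ℝ → ℝ} (hpos : GrowthPos φ)
    (hD : DoublingWith A φ) {C₀ : ℝ} (x : EuclideanSpace ℝ (Fin n)) {r : ℝ} (hr : 0 < r)
    (hint : IntegrableOn (fun t => φ x t / t) (Set.Ioc 0 r) volume ∧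
      ∫ t in Set.Ioc (0 : ℝ) r, φ x t / t ≤ C₀ * φ x r) (N : ℕ) :
    ∑ k ∈ Finset.range N, φ x (r / 2 ^ k) ≤ 2 * A * C₀ * φ x r := by
  have hii : ∀ a b : ℝ, 0 ≤ a → a ≤ b → b ≤ r →
      IntervalIntegrable (fun t => φ x t / t) volume a b := fun a b ha hab hb => by
    rw [intervalIntegrable_iff_integrableOn_Ioc_of_le hab]
    exact hint.1.mono_set (Set.Ioc_subset_Ioc ha hb)
  have hle : ∀ k : ℕ, r / 2 ^ k ≤ r := fun k => div_le_self hr.le (one_le_pow₀ (by norm_num))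
  have hhalf : ∀ k : ℕ, r / 2 ^ (k + 1) = r / 2 ^ k / 2 := fun k => by rw [pow_succ]; field_simp
  have key : ∀ N : ℕ, ∑ k ∈ Finset.range N, φ x (r / 2 ^ k) ≤
      2 * A * ∫ t in (r / 2 ^ N)..r, φ x t / t := by
    intro N
    induction N with
    | zero => simp
    | succ N ih =>
      have hq : 0 < r / 2 ^ N := by positivity
      have h1 := hii (r / 2 ^ N / 2) (r / 2 ^ N) (by positivity) (by linarith) (hle N)
      have h2 := aux_piece hA hpos hD x hq h1
      rw [Finset.sum_range_succ, hhalf, ← intervalIntegral.integral_add_adjacent_intervals h1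
        (hii _ _ hq.le (hle N) le_rfl)]
      linarith
  refine (key N).trans ?_
  rw [mul_assoc (2 * A)]
  gcongr
  refine le_trans ?_ hint.2
  rw [intervalIntegral.integral_of_le (hle N)]
  refine setIntegral_mono_set hint.1 ?_
    (LE.le.eventuallyLE (Set.Ioc_subset_Ioc_left (by positivity)))
  rw [EventuallyLE, ae_restrict_iff' measurableSet_Ioc]
  exact Eventually.of_forall fun t ht => (div_pos (hpos x t ht.1) ht.1).le

lemma aux_lebesgue {f : EuclideanSpace ℝ (Fin n) → ℝ} (hf : LocallyIntegrable f volume) :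
    ∀ᵐ x, Tendsto (fun k : ℕ => ballAvg f x (1 / 2 ^ k)) atTop (nhds (f x)) := by
  filter_upwards [IsUnifLocDoublingMeasure.ae_tendsto_average volume hf 1] with x hx
  have h1 : Tendsto (fun k : ℕ => (1 : ℝ) / 2 ^ k) atTop (nhdsWithin 0 (Set.Ioi 0)) := by
    rw [tendsto_nhdsWithin_iff]
    refine ⟨?_, Eventually.of_forall fun k => by simp⟩
    have := tendsto_pow_atTop_nhds_zero_of_lt_one (r := (1 / 2 : ℝ)) (by norm_num) (by norm_num)
    simpa using this
  have h2 := hx (fun _ => x) _ h1 (Eventually.of_forall fun k => by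
    simp)
  refine h2.congr fun k => ?_
  have hk : (0 : ℝ) < 1 / 2 ^ k := by positivity
  rw [← setAverage_congr (s := ball x (1 / 2 ^ k)) (t := closedBall x (1 / 2 ^ k)), setAverage_eq]
  · rfl
  · refine ae_eq_of_subset_of_measure_ge ball_subset_closedBall ?_
      measurableSet_ball.nullMeasurableSet measure_closedBall_lt_top.ne
    rw [Measure.addHaar_closedBall volume x hk.le, Measure.addHaar_ball_of_pos volume x hk]


lemma aux_osc {A : ℝ} (hA : 0 < A) {φ : EuclideanSpace ℝ (Fin n) → ℝ → ℝ} (hpos : GrowthPos φ)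
    (hD : DoublingWith A φ) {C₀ : ℝ}
    (hint : ∀ (x : EuclideanSpace ℝ (Fin n)) (r : ℝ), 0 < r →
      IntegrableOn (fun t => φ x t / t) (Set.Ioc 0 r) volume ∧
      ∫ t in Set.Ioc (0 : ℝ) r, φ x t / t ≤ C₀ * φ x r)
    {f : EuclideanSpace ℝ (Fin n) → ℝ} (hf : LocallyIntegrable f volume) {M : ℝ} (hM : 0 ≤ M)
    (hK : ∀ x r, 0 < r →
      (volume (ball x r)).toReal⁻¹ * ∫ z in ball x r, |f z - ballAvg f x r| ≤ M * φ x r)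
    (x : EuclideanSpace ℝ (Fin n)) {r s : ℝ} (hs : 0 < s) (hsr : s ≤ r) :
    |ballAvg f x s - ballAvg f x r| ≤ 2 ^ n * M * (2 * A * C₀) * φ x r := by
  have hr : 0 < r := hs.trans_le hsr
  have key : ∀ N : ℕ, |ballAvg f x (r / 2 ^ N) - ballAvg f x r| ≤
      2 ^ n * M * ∑ k ∈ Finset.range N, φ x (r / 2 ^ k) := by
    intro N
    induction N with
    | zero => simp
    | succ N ih =>
      have hq : 0 < r / 2 ^ N := by positivity
      have hhalf : r / 2 ^ (N + 1) = r / 2 ^ N / 2 := by rw [pow_succ]; field_simp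
      have h1 := aux_avg_diff hf x x hq (s := r / 2 ^ (N + 1)) (by positivity)
        (by rw [hhalf]; linarith) (ball_subset_ball (by rw [hhalf]; linarith)) (hK x _ hq)
      rw [Finset.sum_range_succ]
      have h2 := abs_sub_le (ballAvg f x (r / 2 ^ (N + 1))) (ballAvg f x (r / 2 ^ N))
        (ballAvg f x r)
      linarith
  obtain ⟨N, hN1, hN2⟩ := exists_nat_pow_near (x := r / s) (y := (2 : ℝ))
    ((one_le_div hs).2 hsr) (by norm_num)
  have hq : 0 < r / 2 ^ N := by positivity
  rw [le_div_iff₀ hs] at hN1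
  rw [div_lt_iff₀ hs, pow_succ] at hN2
  have h1 := aux_avg_diff hf x x hq hs
    (by rw [div_le_iff₀ (by positivity)]; linarith)
    (ball_subset_ball (by rw [le_div_iff₀ (by positivity)]; linarith)) (hK x _ hq)
  have h2 := abs_sub_le (ballAvg f x s) (ballAvg f x (r / 2 ^ N)) (ballAvg f x r)
  have h3 := aux_sum hA hpos hD x hr (hint x r hr) (N + 1)
  have h4 := mul_le_mul_of_nonneg_left h3 (by positivity : 0 ≤ 2 ^ n * M)
  rw [Finset.sum_range_succ] at h4
  linarith [key N]

lemma aux_holder {A : ℝ} (hA : 0 < A) {φ : EuclideanSpace ℝ (Fin n) → ℝ → ℝ} (hpos : GrowthPos φ)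
    (hD : DoublingWith A φ) (hN : Nearness φ) (hI : AlmostIncreasing φ) {C₀ : ℝ} (hC₀ : 0 < C₀)
    (hint : ∀ (x : EuclideanSpace ℝ (Fin n)) (r : ℝ), 0 < r →
      IntegrableOn (fun t => φ x t / t) (Set.Ioc 0 r) volume ∧
      ∫ t in Set.Ioc (0 : ℝ) r, φ x t / t ≤ C₀ * φ x r)
    {f : EuclideanSpace ℝ (Fin n) → ℝ} (hf : LocallyIntegrable f volume) {M : ℝ} (hM : 0 ≤ M)
    (hK : ∀ x r, 0 < r →
      (volume (ball x r)).toReal⁻¹ * ∫ z in ball x r, |f z - ballAvg f x r| ≤ M * φ x r) :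
    ∃ g : EuclideanSpace ℝ (Fin n) → ℝ, Continuous g ∧ f =ᵐ[volume] g ∧
      ∀ x y, x ≠ y → |g x - g y| ≤ 2 ^ n * (2 * A * C₀ + 1) * (A + 1) * M *
        (φ x (dist x y) + φ y (dist x y)) := by
  have hsum : ∀ x, Summable fun k : ℕ => φ x (1 / 2 ^ k) := fun x =>
    summable_of_sum_range_le (fun k => (hpos x _ (by positivity)).le)
      (fun N => aux_sum hA hpos hD x one_pos (hint x 1 one_pos) N)
  have hlim : ∀ x, ∃ a, Tendsto (fun k : ℕ => ballAvg f x (1 / 2 ^ k)) atTop (nhds a) := by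
    intro x
    refine cauchySeq_tendsto_of_complete (cauchySeq_of_summable_dist ?_)
    refine Summable.of_nonneg_of_le (fun _ => dist_nonneg) (fun k => ?_)
      ((hsum x).mul_left (2 ^ n * M * (2 * A * C₀)))
    rw [dist_comm, Real.dist_eq]
    refine aux_osc hA hpos hD hint hf hM hK x (by positivity) ?_
    gcongr
    · norm_num
    · simp
  choose g hg using hlim
  have hgr : ∀ x r, 0 < r → |g x - ballAvg f x r| ≤ 2 ^ n * M * (2 * A * C₀) * φ x r := by
    intro x r hr
    refine le_of_tendsto ((hg x).sub_const _).abs ?_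
    have h0 : Tendsto (fun k : ℕ => (1 : ℝ) / 2 ^ k) atTop (nhds 0) := by
      simpa using tendsto_pow_atTop_nhds_zero_of_lt_one (r := (1 / 2 : ℝ))
        (by norm_num) (by norm_num)
    filter_upwards [h0.eventually_lt_const hr] with k hk
    exact aux_osc hA hpos hD hint hf hM hK x (by positivity) hk.le
  have hH : ∀ x y, x ≠ y → |g x - g y| ≤ 2 ^ n * (2 * A * C₀ + 1) * (A + 1) * M *
        (φ x (dist x y) + φ y (dist x y)) := by
    intro x y hxy
    have hd : 0 < dist x y := dist_pos.2 hxy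
    set d := dist x y with hdd
    have h1 := hgr x (2 * d) (by positivity)
    have h2 := hgr y d hd
    have h3 := aux_avg_diff hf x y (r := 2 * d) (by positivity) hd le_rfl
      (ball_subset_ball' (by rw [dist_comm]; linarith)) (hK x _ (by positivity))
    have h4 := (hD x d (2 * d) hd (by positivity) (by rw [le_div_iff₀ hd]; linarith)
      (by rw [div_le_iff₀ hd])).2
    rw [div_le_iff₀ (hpos x d hd)] at h4
    have px := hpos x d hd
    have py := hpos y d hd
    have h5 := abs_sub_le (g x) (ballAvg f x (2 * d)) (g y)
    have h6 := abs_sub_le (ballAvg f x (2 * d)) (ballAvg f y d) (g y)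
    rw [abs_sub_comm (ballAvg f x (2 * d)) (ballAvg f y d), abs_sub_comm (ballAvg f y d) (g y)] at h6
    set S := 2 * A * C₀ with hS
    have hS0 : 0 < S := by positivity
    calc |g x - g y| ≤ 2 ^ n * M * ((S + 1) * φ x (2 * d) + S * φ y d) := by linarith
      _ ≤ 2 ^ n * M * ((S + 1) * ((A + 1) * φ x d) + ((S + 1) * (A + 1)) * φ y d) := by
        gcongr
        · linarith
        · nlinarith
      _ = _ := by ring
  refine ⟨g, ?_, ?_, hH⟩
  · rw [continuous_iff_continuousAt]
    intro x
    obtain ⟨A₂, hA₂, hN⟩ := hN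
    obtain ⟨A₃, hA₃, hI⟩ := hI
    set L := 2 ^ n * (2 * A * C₀ + 1) * (A + 1) * M with hL
    have hL0 : 0 ≤ L := by positivity
    have ht : Tendsto (fun k : ℕ => L * ((1 + A₂) * (A₃ * φ x (1 / 2 ^ k)))) atTop (nhds 0) := by
      simpa using (((hsum x).tendsto_atTop_zero.const_mul A₃).const_mul (1 + A₂)).const_mul L
    rw [Metric.continuousAt_iff]
    intro ε hε
    obtain ⟨k, hk⟩ := (ht.eventually_lt_const hε).exists
    refine ⟨1 / 2 ^ k, by positivity, fun {y} hy => ?_⟩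
    by_cases hxy : y = x
    · simpa [hxy] using hε
    have hd : 0 < dist y x := dist_pos.2 hxy
    refine lt_of_le_of_lt ?_ hk
    rw [Real.dist_eq]
    refine (hH y x hxy).trans ?_
    have h1 := (hN y x _ hd le_rfl).2
    rw [div_le_iff₀ (hpos x _ hd)] at h1
    have h2 := hI x _ _ hd hy
    gcongr
    calc _ ≤ (1 + A₂) * φ x (dist y x) := by linarith
      _ ≤ _ := by gcongr
  · filter_upwards [aux_lebesgue hf] with x hx
    exact tendsto_nhds_unique hx (hg x)

lemma aux_conv {p : ℝ} (hp : 1 ≤ p) {g : EuclideanSpace ℝ (Fin n) → ℝ} (hg : Continuous g)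
    (x : EuclideanSpace ℝ (Fin n)) {r T : ℝ} (hr : 0 < r) (hT : 0 ≤ T)
    (h : ∀ y ∈ ball x r, ∀ z ∈ ball x r, |g z - g y| ≤ T) :
    ((volume (ball x r)).toReal⁻¹ * ∫ y in ball x r, |g y - ballAvg g x r| ^ p) ^ (1 / p) ≤ T := by
  have hv := aux_vol_pos x hr
  have hp0 : 0 < p := by linarith
  have avg_le : ∀ (F : EuclideanSpace ℝ (Fin n) → ℝ) (R : ℝ), (∀ y ∈ ball x r, |F y| ≤ R) →
      (volume (ball x r)).toReal⁻¹ * ∫ y in ball x r, F y ≤ R := by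
    intro F R hF
    have h1 := norm_setIntegral_le_of_norm_le_const (μ := volume) (s := ball x r) (f := F) (C := R)
      measure_ball_lt_top hF
    rw [inv_mul_le_iff₀ hv, mul_comm]
    exact (le_abs_self _).trans h1
  have h1 : ∀ y ∈ ball x r, |g y - ballAvg g x r| ≤ T := by
    intro y hy
    rw [abs_sub_comm]
    refine (aux_avg_sub x hr (aux_intOn hg.locallyIntegrable x r) (g y)).trans ?_
    exact avg_le _ _ fun z hz => by rw [abs_abs]; exact h y hy z hz
  have h2 := avg_le (fun y => |g y - ballAvg g x r| ^ p) (T ^ p) fun y hy => by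
    rw [abs_of_nonneg (by positivity)]
    exact Real.rpow_le_rpow (abs_nonneg _) (h1 y hy) hp0.le
  have h0 : 0 ≤ (volume (ball x r)).toReal⁻¹ * ∫ y in ball x r, |g y - ballAvg g x r| ^ p :=
    mul_nonneg (by positivity) (integral_nonneg fun _ => by positivity)
  have := Real.rpow_le_rpow h0 h2 (by positivity : 0 ≤ 1 / p)
  rwa [← Real.rpow_mul hT, mul_one_div_cancel hp0.ne', Real.rpow_one] at this

lemma aux_camp_le {p : ℝ} (hp : 1 ≤ p) {A A₂ A₃ : ℝ} (hA : 0 < A) (hA₂ : 0 < A₂) (hA₃ : 0 < A₃)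
    {φ : EuclideanSpace ℝ (Fin n) → ℝ → ℝ} (hpos : GrowthPos φ)
    (hD : DoublingWith A φ)
    (hN : ∀ (x y : EuclideanSpace ℝ (Fin n)) (r : ℝ), 0 < r → dist x y ≤ r →
      A₂⁻¹ ≤ φ x r / φ y r ∧ φ x r / φ y r ≤ A₂)
    (hI : ∀ (x : EuclideanSpace ℝ (Fin n)) (r s : ℝ), 0 < r → r < s → φ x r ≤ A₃ * φ x s)
    {g : EuclideanSpace ℝ (Fin n) → ℝ} (hg : Continuous g) (hfin : holderSemi φ g < ⊤) :
    campSemi p φ g ≤ ENNReal.ofReal (A₃ * A₂ * A) * holderSemi φ g := by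
  set H := (holderSemi φ g).toReal with hH
  have hH0 : 0 ≤ H := ENNReal.toReal_nonneg
  have hHe : holderSemi φ g = ENNReal.ofReal H := (ENNReal.ofReal_toReal hfin.ne).symm
  have hb : ∀ x y, x ≠ y → 2 * |g x - g y| / (φ x (dist x y) + φ y (dist x y)) ≤ H := by
    intro x y hxy
    rw [← ENNReal.ofReal_le_ofReal_iff hH0, ← hHe]
    exact le_iSup_of_le x (le_iSup_of_le y (le_iSup_of_le hxy le_rfl))
  rw [hHe, ← ENNReal.ofReal_mul (by positivity)]
  refine iSup_le fun x => iSup_le fun r => iSup_le fun hr => ENNReal.ofReal_le_ofReal ?_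
  have hx := hpos x r hr
  rw [inv_mul_le_iff₀ hx]
  refine aux_conv hp hg x hr (by positivity) ?_
  have hφ : ∀ y ∈ ball x r, ∀ d, 0 < d → d < 2 * r → φ y d ≤ A₃ * A₂ * A * φ x r := by
    intro y hy d hd hd2
    have h1 := hI y d (2 * r) hd hd2
    have h2 := (hN y x (2 * r) (by positivity) (by rw [mem_ball] at hy; linarith)).2
    rw [div_le_iff₀ (hpos x _ (by positivity))] at h2
    have h4 := (hD x r (2 * r) hr (by positivity) (by rw [le_div_iff₀ hr]; linarith)
      (by rw [div_le_iff₀ hr])).2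
    rw [div_le_iff₀ hx] at h4
    calc φ y d ≤ A₃ * (A₂ * (A * φ x r)) := by
          refine h1.trans ?_
          gcongr
          refine h2.trans ?_
          gcongr
      _ = _ := by ring
  intro y hy z hz
  by_cases hzy : z = y
  · rw [hzy, sub_self, abs_zero]; positivity
  have hd : 0 < dist z y := dist_pos.2 hzy
  have hd2 : dist z y < 2 * r := by
    have := dist_triangle_right z y x
    rw [mem_ball] at hy hz
    linarith
  have h1 := hb z y hzy
  rw [div_le_iff₀ (add_pos (hpos z _ hd) (hpos y _ hd))] at h1
  have h2 := hφ y hy _ hd hd2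
  have h3 := hφ z hz _ hd hd2
  have h4 := mul_le_mul_of_nonneg_left (add_le_add h3 h2) hH0
  linarith

lemma aux_camp_congr {p : ℝ} {φ : EuclideanSpace ℝ (Fin n) → ℝ → ℝ}
    {f g : EuclideanSpace ℝ (Fin n) → ℝ} (h : f =ᵐ[volume] g) :
    campSemi p φ f = campSemi p φ g := by
  have h1 : ∀ x r, ballAvg f x r = ballAvg g x r := fun x r => by
    unfold ballAvg
    have h2 : ∫ y in ball x r, f y = ∫ y in ball x r, g y := integral_congr_ae (ae_restrict_of_ae h)
    rw [h2]
  have h2 : ∀ x r, ∫ y in ball x r, |f y - ballAvg f x r| ^ p =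
      ∫ y in ball x r, |g y - ballAvg g x r| ^ p := fun x r => by
    refine integral_congr_ae (ae_restrict_of_ae ?_)
    filter_upwards [h] with y hy
    rw [hy, h1]
  unfold campSemi
  simp only [h2]

end helpers

/-- Under (D), (N), (I) and `∫₀^r φ(x,t)/t dt ≤ C₀ φ(x,r)`, for every
`1 ≤ p < ∞` the Campanato space `𝓛_{p,φ}` coincides with the Hölder space `Λ_φ`
with equivalent seminorms. -/
theorem campanato_eq_holder (n : ℕ) (p : ℝ) (hp : 1 ≤ p)
    (φ : EuclideanSpace ℝ (Fin n) → ℝ → ℝ) (hpos : GrowthPos φ)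
    (hD : Doubling φ) (hN : Nearness φ) (hI : AlmostIncreasing φ)
    (C₀ : ℝ) (hC₀ : 0 < C₀)
    (hint : ∀ (x : EuclideanSpace ℝ (Fin n)) (r : ℝ), 0 < r →
      IntegrableOn (fun t => φ x t / t) (Set.Ioc 0 r) volume ∧
      ∫ t in Set.Ioc (0 : ℝ) r, φ x t / t ≤ C₀ * φ x r) :
    ∃ C > 0,
      (∀ f : EuclideanSpace ℝ (Fin n) → ℝ, MemLpLoc p f → campSemi p φ f < ⊤ →
        ∃ g : EuclideanSpace ℝ (Fin n) → ℝ, Continuous g ∧ f =ᵐ[volume] g ∧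
          ENNReal.ofReal C⁻¹ * holderSemi φ g ≤ campSemi p φ f ∧
          campSemi p φ f ≤ ENNReal.ofReal C * holderSemi φ g) ∧
      (∀ g : EuclideanSpace ℝ (Fin n) → ℝ, Continuous g → holderSemi φ g < ⊤ →
        campSemi p φ g ≤ ENNReal.ofReal C * holderSemi φ g) := by
  obtain ⟨A, hA, hD⟩ := hD
  obtain ⟨A₂, hA₂, hN'⟩ := id hN
  obtain ⟨A₃, hA₃, hI'⟩ := id hI
  set C₁ := 2 * (2 ^ n * (2 * A * C₀ + 1) * (A + 1)) with hC₁
  have hC₁0 : 0 < C₁ := by positivity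
  set K := A₃ * A₂ * A with hKd
  have hK0 : 0 < K := by positivity
  have hconv : ∀ g : EuclideanSpace ℝ (Fin n) → ℝ, Continuous g → holderSemi φ g < ⊤ →
        campSemi p φ g ≤ ENNReal.ofReal (C₁ + K) * holderSemi φ g := by
    intro g hg hfin
    refine (aux_camp_le hp hA hA₂ hA₃ hpos hD hN' hI' hg hfin).trans ?_
    gcongr
    linarith
  refine ⟨C₁ + K, by positivity, ?_, hconv⟩
  intro f hf hfin
  set M := (campSemi p φ f).toReal with hM
  have hM0 : 0 ≤ M := ENNReal.toReal_nonneg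
  have hMe : campSemi p φ f = ENNReal.ofReal M := (ENNReal.ofReal_toReal hfin.ne).symm
  have hK : ∀ x r, 0 < r →
      (volume (ball x r)).toReal⁻¹ * ∫ z in ball x r, |f z - ballAvg f x r| ≤ M * φ x r := by
    intro x r hr
    refine (aux_jensen hp hf x hr _).trans ?_
    rw [mul_comm M, ← inv_mul_le_iff₀ (hpos x r hr), ← ENNReal.ofReal_le_ofReal_iff hM0, ← hMe]
    exact le_iSup_of_le x (le_iSup_of_le r (le_iSup_of_le hr le_rfl))
  obtain ⟨g, hg, hfg, hH⟩ := aux_holder hA hpos hD hN hI hC₀ hint hf.1 hM0 hK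
  have hle : holderSemi φ g ≤ ENNReal.ofReal ((C₁ + K) * M) := by
    refine iSup_le fun x => iSup_le fun y => iSup_le fun hxy => ENNReal.ofReal_le_ofReal ?_
    have hd : 0 < dist x y := dist_pos.2 hxy
    have hs := add_pos (hpos x _ hd) (hpos y _ hd)
    rw [div_le_iff₀ hs]
    have h1 := hH x y hxy
    calc 2 * |g x - g y| ≤ C₁ * M * (φ x (dist x y) + φ y (dist x y)) := by
          rw [hC₁]; linarith
      _ ≤ _ := by gcongr; linarith
  refine ⟨g, hg, hfg, ?_, ?_⟩
  · rw [hMe]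
    calc _ ≤ ENNReal.ofReal (C₁ + K)⁻¹ * ENNReal.ofReal ((C₁ + K) * M) := by gcongr
      _ = ENNReal.ofReal M := by
        rw [← ENNReal.ofReal_mul (by positivity), inv_mul_cancel_left₀ (by positivity)]
  · rw [aux_camp_congr hfg]
    exact hconv g hg (hle.trans_lt ENNReal.ofReal_lt_top)

end
end

section
/- Let 1 ≤ p < ∞ and let φ : ℝⁿ × (0,∞) → (0,∞) satisfy conditions (D) and (N), and assume there is C₀ > 0 with ∫_r^∞ φ(x,t)/t dt ≤ C₀ φ(x,r) for all x ∈ ℝⁿ and r > 0. Then for every f with ‖f‖_{𝓛_{p,φ}} < ∞ the limit σ(f) = lim_{r→∞} f_{B(0,r)} exists, and there is a constant C > 0 (independent of f) such that C⁻¹‖f‖_{𝓛_{p,φ}} ≤ ‖f − σ(f)‖_{L_{p,φ}} ≤ C‖f‖_{𝓛_{p,φ}}; that is, f ↦ f − σ(f) is bijective and bicontinuous from 𝓛_{p,φ}(ℝⁿ) modulo constants onto the Morrey space L_{p,φ}(ℝⁿ). -/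
open MeasureTheory Metric Filter
open scoped ENNReal NNReal

noncomputable section

section helpers

variable {n : ℕ}

local notation "E" => EuclideanSpace ℝ (Fin n)

def nrm (p : ℝ) (x : E) (r : ℝ) (g : E → ℝ) : ℝ :=
  ((volume (ball x r)).toReal⁻¹ * ∫ y in ball x r, |g y| ^ p) ^ (1 / p)

def muB (x : E) (r : ℝ) : Measure E := (volume (ball x r))⁻¹ • volume.restrict (ball x r)

lemma vol_pos_s2 (x : E) {r : ℝ} (hr : 0 < r) : 0 < (volume (ball x r)).toReal :=
  ENNReal.toReal_pos (measure_ball_pos volume x hr).ne' measure_ball_lt_top.ne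

lemma muB_prob (x : E) {r : ℝ} (hr : 0 < r) : IsProbabilityMeasure (muB x r) := by
  constructor
  simp only [muB, Measure.smul_apply, Measure.restrict_apply_univ, smul_eq_mul]
  exact ENNReal.inv_mul_cancel (measure_ball_pos volume x hr).ne' measure_ball_lt_top.ne

lemma int_muB (x : E) (r : ℝ) (g : E → ℝ) :
    ∫ y, g y ∂(muB x r) = (volume (ball x r)).toReal⁻¹ * ∫ y in ball x r, g y := by
  simp [muB, integral_smul_measure, ENNReal.toReal_inv]

lemma memLp_of (p : ℝ) (hp : 1 ≤ p) (f : E → ℝ) (hf : MemLpLoc p f) (x : E) {r : ℝ} (hr : 0 < r) :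
    MemLp f (ENNReal.ofReal p) (muB x r) := by
  have h0 : (volume (ball x r))⁻¹ ≠ ⊤ :=
    ENNReal.inv_ne_top.2 (measure_ball_pos volume x hr).ne'
  refine MemLp.smul_measure ?_ h0
  have hm : AEStronglyMeasurable f (volume.restrict (ball x r)) :=
    hf.1.aestronglyMeasurable.restrict
  have hp0 : ENNReal.ofReal p ≠ 0 := by
    simp; linarith
  rw [← integrable_norm_rpow_iff hm hp0 ENNReal.ofReal_ne_top]
  rw [ENNReal.toReal_ofReal (by linarith)]
  exact hf.2 x r hr

lemma nrm_eq (p : ℝ) (hp : 1 ≤ p) (x : E) (r : ℝ) (g : E → ℝ)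
    (hg : MemLp g (ENNReal.ofReal p) (muB x r)) :
    nrm p x r g = (eLpNorm g (ENNReal.ofReal p) (muB x r)).toReal := by
  have hp0 : ENNReal.ofReal p ≠ 0 := by
    simp; linarith
  rw [hg.eLpNorm_eq_integral_rpow_norm hp0 ENNReal.ofReal_ne_top,
    ENNReal.toReal_ofReal (by positivity), ENNReal.toReal_ofReal (by linarith), int_muB]
  simp [nrm]

lemma nrm_sub_const (p : ℝ) (hp : 1 ≤ p) (x : E) {r : ℝ} (hr : 0 < r) (g : E → ℝ)
    (hg : MemLp g (ENNReal.ofReal p) (muB x r)) (c : ℝ) :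
    nrm p x r (fun y => g y - c) ≤ nrm p x r g + |c| := by
  have := muB_prob x hr
  have hc : MemLp (fun _ : E => c) (ENNReal.ofReal p) (muB x r) := memLp_const c
  have hp1 : 1 ≤ ENNReal.ofReal p := by simpa using hp
  have h := eLpNorm_sub_le hg.1 hc.1 hp1
  rw [nrm_eq p hp x r (fun y => g y - c) (hg.sub hc), nrm_eq p hp x r g hg]
  have h2 : (eLpNorm (fun _ : E => c) (ENNReal.ofReal p) (muB x r)).toReal = |c| := by
    rw [eLpNorm_const c (by positivity) (IsProbabilityMeasure.ne_zero _)]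
    simp
  rw [← h2, ← ENNReal.toReal_add hg.2.ne hc.2.ne]
  exact ENNReal.toReal_mono (ENNReal.add_ne_top.2 ⟨hg.2.ne, hc.2.ne⟩) h

lemma avg_abs_le (p : ℝ) (hp : 1 ≤ p) (x : E) {r : ℝ} (hr : 0 < r) (g : E → ℝ)
    (hg : MemLp g (ENNReal.ofReal p) (muB x r)) :
    (volume (ball x r)).toReal⁻¹ * ∫ y in ball x r, |g y| ≤ nrm p x r g := by
  have := muB_prob x hr
  have hp1 : 1 ≤ ENNReal.ofReal p := by simpa using hp
  have h := eLpNorm_le_eLpNorm_of_exponent_le hp1 hg.1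
  have h1 : MemLp g 1 (muB x r) := hg.mono_exponent hp1
  rw [nrm_eq p hp x r g hg, ← int_muB]
  have h2 := ENNReal.toReal_mono hg.2.ne h
  rw [h1.eLpNorm_eq_integral_rpow_norm (by simp) (by simp), ENNReal.toReal_ofReal (by positivity)] at h2
  simpa using h2

lemma ballAvg_sub (f : E → ℝ) (hf : LocallyIntegrable f volume) (x : E) {r : ℝ} (hr : 0 < r)
    (c : ℝ) : |ballAvg f x r - c| ≤
      (volume (ball x r)).toReal⁻¹ * ∫ y in ball x r, |f y - c| := by
  have hi : IntegrableOn f (ball x r) :=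
    (hf.integrableOn_isCompact (isCompact_closedBall x r)).mono_set ball_subset_closedBall
  have hic : IntegrableOn (fun _ : E => c) (ball x r) :=
    integrableOn_const measure_ball_lt_top.ne
  have hv := vol_pos_s2 x hr
  have h : ballAvg f x r - c = (volume (ball x r)).toReal⁻¹ * ∫ y in ball x r, (f y - c) := by
    rw [integral_sub hi hic, ballAvg]
    simp only [integral_const, smul_eq_mul, Measure.real, Measure.restrict_apply_univ]
    field_simp
  rw [h, abs_mul, abs_of_pos (inv_pos.2 hv)]
  gcongr
  exact abs_integral_le_integral_abs

lemma avg_diff (p : ℝ) (hp : 1 ≤ p) (f : E → ℝ) (hf : MemLpLoc p f) (x z : E) {r s : ℝ}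
    (hr : 0 < r) (hs : 0 < s) (hsr : s ≤ 2 * r) (hsub : ball x r ⊆ ball z s) :
    |ballAvg f x r - ballAvg f z s| ≤
      2 ^ n * nrm p z s (fun y => f y - ballAvg f z s) := by
  set c := ballAvg f z s
  refine (ballAvg_sub f hf.1 x hr c).trans ?_
  have hm : MemLp (fun y => f y - c) (ENNReal.ofReal p) (muB z s) := by
    have := muB_prob z hs
    exact (memLp_of p hp f hf z hs).sub (memLp_const c)
  have h1 := avg_abs_le p hp z hs _ hm
  have hvx := vol_pos_s2 x hr
  have hvz := vol_pos_s2 z hs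
  have hi : IntegrableOn (fun y => |f y - c|) (ball z s) := by
    have hi : IntegrableOn f (ball z s) :=
      (hf.1.integrableOn_isCompact (isCompact_closedBall z s)).mono_set ball_subset_closedBall
    exact (hi.sub (integrableOn_const measure_ball_lt_top.ne)).abs
  have h2 : ∫ y in ball x r, |f y - c| ≤ ∫ y in ball z s, |f y - c| :=
    setIntegral_mono_set hi (ae_of_all _ fun y => abs_nonneg _) hsub.eventuallyLE
  have h3 : (volume (ball z s)).toReal ≤ 2 ^ n * (volume (ball x r)).toReal := by
    have e : volume (ball z (2 * r)) = ENNReal.ofReal (2 ^ n) * volume (ball x r) := by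
      rw [Measure.addHaar_ball_mul_of_pos volume z (by norm_num : (0:ℝ) < 2) r,
        Measure.addHaar_ball_center volume x r]
      simp
    have := ENNReal.toReal_mono measure_ball_lt_top.ne
      (measure_mono (μ := volume) (ball_subset_ball hsr : ball z s ⊆ ball z (2 * r)))
    rwa [e, ENNReal.toReal_mul, ENNReal.toReal_ofReal (by positivity)] at this
  set I := ∫ y in ball z s, |f y - c|
  have hI : 0 ≤ I := integral_nonneg fun y => abs_nonneg _
  calc (volume (ball x r)).toReal⁻¹ * ∫ y in ball x r, |f y - c|
      ≤ (volume (ball x r)).toReal⁻¹ * I := by gcongr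
    _ ≤ 2 ^ n * ((volume (ball z s)).toReal⁻¹ * I) := by
        rw [← mul_assoc]
        gcongr
        rw [inv_le_iff_one_le_mul₀ hvx, mul_right_comm, ← div_eq_mul_inv, le_div_iff₀ hvz]
        linarith
    _ ≤ _ := by gcongr

end helpers

/-- Under (D), (N) and `∫_r^∞ φ(x,t)/t dt ≤ C₀ φ(x,r)`, for every
`f ∈ 𝓛_{p,φ}` the limit `σ(f) = lim_{r→∞} f_{B(0,r)}` exists, and
`f ↦ f − σ(f)` identifies `𝓛_{p,φ}` (modulo constants) with the Morrey space `L_{p,φ}`. -/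
theorem campanato_eq_morrey_mod_constants (n : ℕ) (p : ℝ) (hp : 1 ≤ p)
    (φ : EuclideanSpace ℝ (Fin n) → ℝ → ℝ) (hpos : GrowthPos φ)
    (hD : Doubling φ) (hN : Nearness φ)
    (C₀ : ℝ) (hC₀ : 0 < C₀)
    (hint : ∀ (x : EuclideanSpace ℝ (Fin n)) (r : ℝ), 0 < r →
      IntegrableOn (fun t => φ x t / t) (Set.Ioi r) volume ∧
      ∫ t in Set.Ioi r, φ x t / t ≤ C₀ * φ x r) :
    ∃ C > 0, ∀ f : EuclideanSpace ℝ (Fin n) → ℝ, MemLpLoc p f → campSemi p φ f < ⊤ →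
      ∃ σf : ℝ, Tendsto (fun r => ballAvg f 0 r) atTop (nhds σf) ∧
        ENNReal.ofReal C⁻¹ * campSemi p φ f ≤ morreyNorm p φ (fun x => f x - σf) ∧
        morreyNorm p φ (fun x => f x - σf) ≤ ENNReal.ofReal C * campSemi p φ f := by
  obtain ⟨A, hA, hDA⟩ := hD
  -- nondegeneracy of A
  have hφ1 : ∀ x r s, 0 < r → 0 < s → s ≤ 2 * r → r ≤ 2 * s → φ x s ≤ A * φ x r := by
    intro x r s hr hs h1 h2
    have h := (hDA x r s hr hs (by rw [le_div_iff₀ hr]; linarith) (by rw [div_le_iff₀ hr]; linarith)).2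
    rwa [div_le_iff₀ (hpos x r hr)] at h
  let G : EuclideanSpace ℝ (Fin n) → ℝ → ℝ := fun x r => ∫ t in Set.Ioi r, φ x t / t
  have hG0 : ∀ x r, 0 < r → 0 ≤ G x r := by
    intro x r hr
    refine setIntegral_nonneg measurableSet_Ioi fun t ht => ?_
    have ht0 : 0 < t := hr.trans ht
    exact (div_pos (hpos x t ht0) ht0).le
  have hGφ : ∀ x r, 0 < r → φ x r ≤ 2 * A * (G x (r / 2) - G x r) := by
    intro x r hr
    have hi := (hint x (r / 2) (by linarith)).1
    have hsplit : G x (r / 2) = (∫ t in Set.Ioc (r / 2) r, φ x t / t) + G x r := by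
      simp only [G]
      rw [← Set.Ioc_union_Ioi_eq_Ioi (by linarith : r / 2 ≤ r)]
      exact setIntegral_union (Set.Ioc_disjoint_Ioi le_rfl) measurableSet_Ioi
        (hi.mono_set Set.Ioc_subset_Ioi_self) (hint x r hr).1
    have hle : ∫ t in Set.Ioc (r / 2) r, φ x r / (A * r) ≤ ∫ t in Set.Ioc (r / 2) r, φ x t / t := by
      refine setIntegral_mono_on (integrableOn_const (by simp))
        (hi.mono_set Set.Ioc_subset_Ioi_self) measurableSet_Ioc fun t ht => ?_
      have ht0 : 0 < t := by linarith [ht.1]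
      have h1 := hφ1 x t r ht0 hr (by linarith [ht.1]) (by linarith [ht.2])
      have h2 := hpos x t ht0
      rw [div_le_div_iff₀ (by positivity) ht0]
      calc φ x r * t ≤ (A * φ x t) * r := by
            gcongr
            exact ht.2
        _ = _ := by ring
    have hc : ∫ t in Set.Ioc (r / 2) r, φ x r / (A * r) = φ x r / (2 * A) := by
      rw [setIntegral_const]
      simp only [Measure.real, Real.volume_Ioc, smul_eq_mul]
      rw [ENNReal.toReal_ofReal (by linarith)]
      field_simp
      ring
    rw [hc] at hle
    rw [div_le_iff₀ (by positivity)] at hle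
    rw [hsplit]
    linarith
  have hGlim : ∀ x, Tendsto (fun r => G x (r / 2)) atTop (nhds 0) := by
    intro x
    have h1 := intervalIntegral_tendsto_integral_Ioi 1 (hint x 1 one_pos).1 tendsto_id
    have h2 : Tendsto (fun r => G x r) atTop (nhds 0) := by
      have h3 := (tendsto_const_nhds (x := G x 1)).sub h1
      have : G x 1 - ∫ t in Set.Ioi 1, φ x t / t = 0 := sub_self _
      rw [this] at h3
      refine h3.congr' ?_
      filter_upwards [eventually_ge_atTop 1] with r hr
      simp only [G, id]
      rw [intervalIntegral.integral_of_le hr, ← Set.Ioc_union_Ioi_eq_Ioi hr,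
        setIntegral_union (Set.Ioc_disjoint_Ioi le_rfl) measurableSet_Ioi
        ((hint x 1 one_pos).1.mono_set Set.Ioc_subset_Ioi_self)
        (hint x r (by linarith)).1]
      ring
    exact h2.comp (tendsto_id.atTop_div_const (by norm_num))
  let C1 : ℝ := 2 ^ n * A * (2 * A)
  have hC1 : 0 < C1 := by positivity
  refine ⟨2 + C1 * C₀ * A, by positivity, fun f hf hfin => ?_⟩
  set M := (campSemi p φ f).toReal with hM
  have hM0 : 0 ≤ M := ENNReal.toReal_nonneg
  have hcamp : ∀ x r, 0 < r → nrm p x r (fun y => f y - ballAvg f x r) ≤ M * φ x r := by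
    intro x r hr
    have h : ENNReal.ofReal ((φ x r)⁻¹ * nrm p x r (fun y => f y - ballAvg f x r)) ≤ campSemi p φ f :=
      le_iSup_of_le x (le_iSup_of_le r (le_iSup_of_le hr le_rfl))
    have h2 := (ENNReal.ofReal_le_iff_le_toReal hfin.ne).1 h
    rwa [inv_mul_le_iff₀ (hpos x r hr), mul_comm] at h2
  have hstep : ∀ x r R, 0 < r → r ≤ R → R ≤ 2 * r →
      |ballAvg f x R - ballAvg f x r| ≤ M * C1 * (G x (r / 2) - G x r) := by
    intro x r R hr h1 h2
    rw [abs_sub_comm]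
    have hR : 0 < R := by linarith
    calc _ ≤ 2 ^ n * nrm p x R (fun y => f y - ballAvg f x R) :=
          avg_diff p hp f hf x x hr hR h2 (ball_subset_ball h1)
      _ ≤ 2 ^ n * (M * (A * (2 * A * (G x (r / 2) - G x r)))) := by
          have := hcamp x R hR
          have := hφ1 x r R hr hR h2 (by linarith)
          have := hGφ x r hr
          gcongr
          refine (hcamp x R hR).trans ?_
          gcongr
          refine (hφ1 x r R hr hR h2 (by linarith)).trans ?_
          gcongr
      _ = _ := by simp only [C1]; ring
  have hind : ∀ (k : ℕ) x r R, 0 < r → r ≤ R → R ≤ 2 ^ (k + 1) * r →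
      |ballAvg f x R - ballAvg f x r| ≤ M * C1 * G x (r / 2) := by
    have hsm : ∀ x r R, 0 < r → r ≤ R → R ≤ 2 * r →
        |ballAvg f x R - ballAvg f x r| ≤ M * C1 * G x (r / 2) := by
      intro x r R hr h1 h2
      refine (hstep x r R hr h1 h2).trans ?_
      gcongr
      linarith [hG0 x r hr]
    intro k
    induction k with
    | zero => 
      intro x r R hr h1 h2
      exact hsm x r R hr h1 (by simpa using h2)
    | succ k ih =>
      intro x r R hr h1 h2
      rcases le_total R (2 * r) with h3 | h3
      · exact hsm x r R hr h1 h3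
      · have a := ih x (2 * r) R (by linarith) h3 (by rw [pow_succ] at h2; linarith)
        have b := hstep x r (2 * r) hr (by linarith) le_rfl
        have e : 2 * r / 2 = r := by ring
        rw [e] at a
        have := abs_sub_le (ballAvg f x R) (ballAvg f x (2 * r)) (ballAvg f x r)
        linarith
  have hall : ∀ x r R, 0 < r → r ≤ R →
      |ballAvg f x R - ballAvg f x r| ≤ M * C1 * G x (r / 2) := by
    intro x r R hr h1
    obtain ⟨k, hk⟩ := pow_unbounded_of_one_lt (R / r) (by norm_num : (1:ℝ) < 2)
    rw [div_lt_iff₀ hr] at hk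
    refine hind k x r R hr h1 (hk.le.trans ?_)
    gcongr
    · norm_num
    · omega
  have hMG : ∀ x, Tendsto (fun r => M * C1 * G x (r / 2)) atTop (nhds 0) := by
    intro x
    simpa using (hGlim x).const_mul (M * C1)
  obtain ⟨σ, hσ⟩ : ∃ σ, Tendsto (fun r => ballAvg f 0 r) atTop (nhds σ) := by
    apply cauchySeq_tendsto_of_complete
    rw [Metric.cauchySeq_iff']
    intro ε hε
    obtain ⟨N, hN1, hN2⟩ := (((hMG 0).eventually_lt_const hε).and (eventually_gt_atTop 0)).exists
    refine ⟨N, fun R hR => ?_⟩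
    rw [Real.dist_eq]
    exact (hall 0 N R hN2 hR).trans_lt hN1
  have hσx : ∀ x, Tendsto (fun r => ballAvg f x r) atTop (nhds σ) := by
    intro x
    have h1 : Tendsto (fun r => ballAvg f 0 (2 * r)) atTop (nhds σ) :=
      hσ.comp (tendsto_id.const_mul_atTop (by norm_num : (0:ℝ) < 2))
    have h2 : Tendsto (fun r => ballAvg f x r - ballAvg f 0 (2 * r)) atTop (nhds 0) := by
      have h3 : Tendsto (fun r => M * C1 * G 0 (r / 2)) atTop (nhds 0) := hMG 0
      refine squeeze_zero_norm' ?_ h3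
      filter_upwards [eventually_gt_atTop 0, eventually_ge_atTop ‖x‖] with r hr hx
      rw [Real.norm_eq_abs]
      calc _ ≤ 2 ^ n * nrm p 0 (2 * r) (fun y => f y - ballAvg f 0 (2 * r)) :=
            avg_diff p hp f hf x 0 hr (by linarith) le_rfl
              (ball_subset_ball' (by rw [dist_zero_right]; linarith))
        _ ≤ 2 ^ n * (M * (A * (2 * A * (G 0 (r / 2))))) := by
            gcongr
            refine (hcamp 0 (2 * r) (by linarith)).trans ?_
            gcongr
            refine (hφ1 0 r (2 * r) hr (by linarith) le_rfl (by linarith)).trans ?_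
            gcongr
            refine (hGφ 0 r hr).trans ?_
            gcongr
            linarith [hG0 0 r hr]
        _ = _ := by simp only [C1]; ring
    have := h2.add h1
    simpa using this
  have hdiff : ∀ x r, 0 < r → |ballAvg f x r - σ| ≤ M * (C1 * C₀ * A) * φ x r := by
    intro x r hr
    have h1 : |σ - ballAvg f x r| ≤ M * C1 * G x (r / 2) := by
      refine le_of_tendsto ((hσx x).sub_const (ballAvg f x r)).abs ?_
      filter_upwards [eventually_ge_atTop r] with R hR
      exact hall x r R hr hR
    rw [abs_sub_comm]
    refine h1.trans ?_
    have h2 : G x (r / 2) ≤ C₀ * φ x (r / 2) := (hint x (r / 2) (by linarith)).2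
    have h3 := hφ1 x r (r / 2) hr (by linarith) (by linarith) (by linarith)
    calc M * C1 * G x (r / 2) ≤ M * C1 * (C₀ * (A * φ x r)) := by
          gcongr
          refine h2.trans ?_
          gcongr
      _ = _ := by ring
  have hmem : ∀ x r c, 0 < r → MemLp (fun y => f y - c) (ENNReal.ofReal p) (muB x r) := by
    intro x r c hr
    have := muB_prob x hr
    exact (memLp_of p hp f hf x hr).sub (memLp_const c)
  have hC : 0 < 2 + C1 * C₀ * A := by positivity
  refine ⟨σ, hσ, ?_, ?_⟩
  · have key : campSemi p φ f ≤ ENNReal.ofReal (2 + C1 * C₀ * A) * morreyNorm p φ (fun x => f x - σ) := by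
      refine iSup_le fun x => iSup_le fun r => iSup_le fun hr => ?_
      have h : ENNReal.ofReal ((φ x r)⁻¹ * nrm p x r (fun y => f y - σ)) ≤
          morreyNorm p φ (fun x => f x - σ) :=
        le_iSup_of_le x (le_iSup_of_le r (le_iSup_of_le hr le_rfl))
      refine le_trans ?_ (mul_le_mul_right h _)
      rw [← ENNReal.ofReal_mul hC.le]
      refine ENNReal.ofReal_le_ofReal ?_
      change (φ x r)⁻¹ * nrm p x r (fun y => f y - ballAvg f x r) ≤ _
      have hs := nrm_sub_const p hp x hr _ (hmem x r σ hr) (ballAvg f x r - σ)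
      simp only [sub_sub_sub_cancel_right] at hs
      have h2 := (ballAvg_sub f hf.1 x hr σ).trans (avg_abs_le p hp x hr _ (hmem x r σ hr))
      have hn : 0 ≤ nrm p x r (fun y => f y - σ) := (abs_nonneg _).trans h2
      have hφ := hpos x r hr
      rw [mul_left_comm]
      gcongr
      have : 0 ≤ C1 * C₀ * A * nrm p x r (fun y => f y - σ) := by positivity
      linarith
    rw [ENNReal.ofReal_inv_of_pos hC]
    calc _ ≤ (ENNReal.ofReal (2 + C1 * C₀ * A))⁻¹ * (ENNReal.ofReal (2 + C1 * C₀ * A) *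
            morreyNorm p φ (fun x => f x - σ)) := mul_le_mul_right key _
      _ = _ := by
        rw [← mul_assoc, ENNReal.inv_mul_cancel (by simpa using hC) ENNReal.ofReal_ne_top, one_mul]
  · refine iSup_le fun x => iSup_le fun r => iSup_le fun hr => ?_
    rw [← ENNReal.ofReal_toReal hfin.ne, ← ENNReal.ofReal_mul hC.le]
    refine ENNReal.ofReal_le_ofReal ?_
    change (φ x r)⁻¹ * nrm p x r (fun y => f y - σ) ≤ _
    have hs := nrm_sub_const p hp x hr _ (hmem x r (ballAvg f x r) hr) (σ - ballAvg f x r)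
    simp only [sub_sub_sub_cancel_right] at hs
    rw [abs_sub_comm] at hs
    have h1 := hcamp x r hr
    have h2 := hdiff x r hr
    have hφ := hpos x r hr
    rw [inv_mul_le_iff₀ hφ]
    have : 0 ≤ M * φ x r := by positivity
    nlinarith

end
end

section
/- Let 1 ≤ p < ∞ and let φ : ℝⁿ × (0,∞) → (0,∞) satisfy the doubling condition (D) and ∫₁^∞ φ(0,t)/t dt < ∞. Then φ(0,r) → 0 as r → ∞, and consequently for every f in the Morrey space L_{p,φ}(ℝⁿ) one has |f_{B(0,r)}| ≤ φ(0,r)‖f‖_{L_{p,φ}} → 0 as r → ∞; in particular σ(f) = lim_{r→∞} f_{B(0,r)} = 0. -/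
open MeasureTheory Metric Filter
open scoped ENNReal NNReal

noncomputable section

/-- If `φ` satisfies (D) and `∫₁^∞ φ(0,t)/t dt < ∞`, then `φ(0,r) → 0`
as `r → ∞`, and for every `f` in the Morrey space `L_{p,φ}` one has
`|f_{B(0,r)}| ≤ φ(0,r) ‖f‖_{L_{p,φ}} → 0`; in particular `σ(f) = 0`. -/
theorem morrey_ball_average_tendsto_zero (n : ℕ) (p : ℝ) (hp : 1 ≤ p)
    (φ : EuclideanSpace ℝ (Fin n) → ℝ → ℝ) (hpos : GrowthPos φ) (hD : Doubling φ)
    (hint : IntegrableOn (fun t => φ 0 t / t) (Set.Ioi (1 : ℝ)) volume) :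
    Tendsto (fun r => φ 0 r) atTop (nhds 0) ∧
    ∀ f : EuclideanSpace ℝ (Fin n) → ℝ, MemLpLoc p f → morreyNorm p φ f < ⊤ →
      (∀ r : ℝ, 0 < r →
        ENNReal.ofReal |ballAvg f 0 r| ≤ ENNReal.ofReal (φ 0 r) * morreyNorm p φ f) ∧
      Tendsto (fun r => ballAvg f 0 r) atTop (nhds 0) := by
  have hφ : Tendsto (fun r => φ 0 r) atTop (nhds 0) := by
    obtain ⟨A, hA, hD⟩ := hD
    have h1 := intervalIntegral_tendsto_integral_Ioi (1 : ℝ) hint tendsto_id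
    have h2 := intervalIntegral_tendsto_integral_Ioi (1 : ℝ) hint
      (tendsto_id.const_mul_atTop (zero_lt_two : (0 : ℝ) < 2))
    have h3 := (h2.sub h1).const_mul (2 * A)
    rw [sub_self, mul_zero] at h3
    refine squeeze_zero' ?_ ?_ h3
    · filter_upwards [eventually_gt_atTop 0] with r hr using (hpos 0 r hr).le
    · filter_upwards [eventually_gt_atTop 1] with r hr
      have hr0 : 0 < r := by linarith
      have hi : ∀ a b : ℝ, 1 ≤ a → a ≤ b →
          IntervalIntegrable (fun t => φ 0 t / t) volume a b := by
        intro a b ha hab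
        rw [intervalIntegrable_iff_integrableOn_Ioc_of_le hab]
        exact hint.mono_set (fun x hx => lt_of_le_of_lt ha hx.1)
      simp only [id]
      rw [intervalIntegral.integral_interval_sub_left (hi 1 (2 * r) le_rfl (by linarith))
        (hi 1 r le_rfl hr.le)]
      have hm : ∫ t in r..(2 * r), A⁻¹ * φ 0 r / (2 * r) ≤ ∫ t in r..(2 * r), φ 0 t / t := by
        apply intervalIntegral.integral_mono_on (by linarith) (by simp)
          (hi r (2 * r) hr.le (by linarith))
        intro t ht
        have ht0 : 0 < t := lt_of_lt_of_le hr0 ht.1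
        have hd := (hD 0 r t hr0 ht0 (by rw [le_div_iff₀ hr0]; linarith [ht.1])
          (by rw [div_le_iff₀ hr0]; exact ht.2)).1
        rw [le_div_iff₀ (hpos 0 r hr0)] at hd
        exact div_le_div₀ (hpos 0 t ht0).le hd ht0 ht.2
      rw [intervalIntegral.integral_const, smul_eq_mul] at hm
      have : (2 * r - r) * (A⁻¹ * φ 0 r / (2 * r)) = φ 0 r / (2 * A) := by
        field_simp
        ring
      rw [this, div_le_iff₀ (by positivity)] at hm
      linarith
  refine ⟨hφ, fun f hf hfin => ?_⟩
  have key : ∀ r : ℝ, 0 < r →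
      ENNReal.ofReal |ballAvg f 0 r| ≤ ENNReal.ofReal (φ 0 r) * morreyNorm p φ f := by
    intro r hr
    have hle : ENNReal.ofReal ((φ 0 r)⁻¹ * ((volume (ball (0 : EuclideanSpace ℝ (Fin n)) r)).toReal⁻¹
        * ∫ y in ball 0 r, |f y| ^ p) ^ (1 / p)) ≤ morreyNorm p φ f :=
      le_iSup_of_le 0 (le_iSup_of_le r (le_iSup_of_le hr le_rfl))
    refine le_trans ?_ (mul_le_mul_right hle _)
    rw [← ENNReal.ofReal_mul (hpos 0 r hr).le, mul_inv_cancel_left₀ (hpos 0 r hr).ne']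
    apply ENNReal.ofReal_le_ofReal
    have hfi : IntegrableOn f (ball 0 r) volume :=
      (hf.1.integrableOn_isCompact (isCompact_closedBall 0 r)).mono_set ball_subset_closedBall
    have hJ := (convexOn_rpow hp).map_set_average_le (μ := volume)
      (t := ball (0 : EuclideanSpace ℝ (Fin n)) r) (f := fun y => |f y|)
      (Real.continuous_rpow_const (by linarith)).continuousOn isClosed_Ici
      (measure_ball_pos _ _ hr).ne' measure_ball_lt_top.ne
      (Eventually.of_forall fun y => abs_nonneg (f y)) hfi.abs (hf.2 0 r hr)
    simp only [setAverage_eq, smul_eq_mul, Measure.real] at hJ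
    have h0 : |ballAvg f 0 r| ≤ (volume (ball (0 : EuclideanSpace ℝ (Fin n)) r)).toReal⁻¹ *
        ∫ y in ball 0 r, |f y| := by
      rw [ballAvg, abs_mul, abs_of_nonneg (inv_nonneg.2 ENNReal.toReal_nonneg)]
      exact mul_le_mul_of_nonneg_left abs_integral_le_integral_abs
        (inv_nonneg.2 ENNReal.toReal_nonneg)
    refine h0.trans ?_
    have hp0 : 0 < p := by linarith
    have hn := (abs_nonneg _).trans h0
    have := Real.rpow_le_rpow (Real.rpow_nonneg hn p) hJ (z := 1 / p) (by positivity)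
    rwa [← Real.rpow_mul hn, mul_one_div_cancel hp0.ne', Real.rpow_one] at this
  refine ⟨key, ?_⟩
  have hlim : Tendsto (fun r => φ 0 r * (morreyNorm p φ f).toReal) atTop (nhds 0) := by
    simpa using hφ.mul_const (morreyNorm p φ f).toReal
  refine squeeze_zero_norm' ?_ hlim
  filter_upwards [eventually_gt_atTop 0] with r hr
  have h := ENNReal.toReal_mono (ENNReal.mul_ne_top ENNReal.ofReal_ne_top hfin.ne) (key r hr)
  rwa [ENNReal.toReal_ofReal (abs_nonneg _), ENNReal.toReal_mul,
    ENNReal.toReal_ofReal (hpos 0 r hr).le] at h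

end
end
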